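/- arXiv:1801.00443 — 7 statements merged into one kernel-verified Lean document; each statement's English description precedes it below -/
import Mathlib

section
/- Fix V > 0 and α1, α2 > 0 with α1 + α2 = 1, and let r* = sup{ r : there exist a feasible trajectory and power allocation (x, p1, p2) and a pair (r1, r2) achievable for it with r1 ≥ α1·r and r2 ≥ α2·r }. Suppose the feasible triple (x*, p1*, p2*), with x* nondecreasing, valued in [-D/2, D/2], x*(0) = x_I, and x*(T) = x_F, attains this supremum, i.e., the pair (α1·r*, α2·r*) is achievable for (x*, p1*, p2*). Then for every x_A with x_I ≤ x_A ≤ x_F, C_f(x_A) ⊆ Conv( C_f(x_I) ∪ C_f(x_F) ), where Conv denotes the convex hull in ℝ². -/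
open MeasureTheory

/-- Channel power gain (normalized by noise) from the UAV at horizontal position `x`
to ground user 1 located at `-D/2`. -/
noncomputable def h1 (D H β0 x : ℝ) : ℝ := β0 / ((x + D / 2) ^ 2 + H ^ 2)

/-- Channel power gain from the UAV at horizontal position `x` to ground user 2
located at `D/2`. -/
noncomputable def h2 (D H β0 x : ℝ) : ℝ := β0 / ((x - D / 2) ^ 2 + H ^ 2)

/-- A feasible trajectory is a `V`-Lipschitz function on `[0, T]`. -/
def FeasibleTraj (V T : ℝ) (x : ℝ → ℝ) : Prop :=
  ∀ s ∈ Set.Icc (0 : ℝ) T, ∀ t ∈ Set.Icc (0 : ℝ) T, |x s - x t| ≤ V * |s - t|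

/-- A feasible power allocation: measurable, nonnegative, total power at most `P`. -/
def FeasiblePower (P T : ℝ) (p1 p2 : ℝ → ℝ) : Prop :=
  Measurable p1 ∧ Measurable p2 ∧
    ∀ t ∈ Set.Icc (0 : ℝ) T, 0 ≤ p1 t ∧ 0 ≤ p2 t ∧ p1 t + p2 t ≤ P

/-- The rate pair `(r1, r2)` is achievable for trajectory `x` and power allocation
`(p1, p2)`. -/
def Achievable (D H β0 T : ℝ) (x p1 p2 : ℝ → ℝ) (r1 r2 : ℝ) : Prop :=
  0 ≤ r1 ∧ 0 ≤ r2 ∧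
    r1 ≤ (1 / T) * ∫ t in (0 : ℝ)..T, Real.logb 2 (1 + p1 t * h1 D H β0 (x t)) ∧
    r2 ≤ (1 / T) * ∫ t in (0 : ℝ)..T, Real.logb 2 (1 + p2 t * h2 D H β0 (x t)) ∧
    r1 + r2 ≤ (1 / T) * ∫ t in (0 : ℝ)..T,
      Real.logb 2 (1 + p1 t * h1 D H β0 (x t) + p2 t * h2 D H β0 (x t))

/-- The capacity region `C(V, T, P)` of the UAV-enabled two-user broadcast channel. -/
def CapacityRegion (D H β0 P V T : ℝ) : Set (ℝ × ℝ) :=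
  {r | ∃ x p1 p2, FeasibleTraj V T x ∧ FeasiblePower P T p1 p2 ∧
    Achievable D H β0 T x p1 p2 r.1 r.2}

/-- The fixed-location MAC-form region `C_MAC(x, p1, p2)`. -/
noncomputable def CMAC (D H β0 : ℝ) (x p1 p2 : ℝ) : Set (ℝ × ℝ) :=
  {r | 0 ≤ r.1 ∧ 0 ≤ r.2 ∧
    r.1 ≤ Real.logb 2 (1 + p1 * h1 D H β0 x) ∧
    r.2 ≤ Real.logb 2 (1 + p2 * h2 D H β0 x) ∧
    r.1 + r.2 ≤ Real.logb 2 (1 + p1 * h1 D H β0 x + p2 * h2 D H β0 x)}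

/-- The fixed-location capacity region `C_f(x)`: the union of `C_MAC(x, p1, p2)`
over all power splits `p1, p2 ≥ 0` with `p1 + p2 ≤ P`. -/
noncomputable def Cf (D H β0 P : ℝ) (x : ℝ) : Set (ℝ × ℝ) :=
  {r | ∃ p1 p2 : ℝ, 0 ≤ p1 ∧ 0 ≤ p2 ∧ p1 + p2 ≤ P ∧ r ∈ CMAC D H β0 x p1 p2}

/-- The capacity region of a two-user channel with constant gains `k1`, `k2`. -/
def gainRegion (k1 k2 P : ℝ) : Set (ℝ × ℝ) :=
  {r | ∃ p1 p2 : ℝ, 0 ≤ p1 ∧ 0 ≤ p2 ∧ p1 + p2 ≤ P ∧ 0 ≤ r.1 ∧ 0 ≤ r.2 ∧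
    r.1 ≤ Real.logb 2 (1 + p1 * k1) ∧ r.2 ≤ Real.logb 2 (1 + p2 * k2) ∧
    r.1 + r.2 ≤ Real.logb 2 (1 + p1 * k1 + p2 * k2)}

/-- The least total power that supports the rate pair `r` at gains `k1`, `k2`. -/
noncomputable def powerCost (k1 k2 : ℝ) (r : ℝ × ℝ) : ℝ :=
  ((2 : ℝ) ^ r.1 - 1) * k1⁻¹ + ((2 : ℝ) ^ r.2 - 1) * k2⁻¹ +
    ((2 : ℝ) ^ r.1 - 1) * ((2 : ℝ) ^ r.2 - 1) * min k1⁻¹ k2⁻¹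

lemma Cf_eq_gainRegion (D H β0 P x : ℝ) :
    Cf D H β0 P x = gainRegion (h1 D H β0 x) (h2 D H β0 x) P := rfl

lemma mem_gainRegion_swap {k1 k2 P : ℝ} {r : ℝ × ℝ} (h : r ∈ gainRegion k1 k2 P) :
    r.swap ∈ gainRegion k2 k1 P := by
  obtain ⟨p1, p2, h1, h2, h3, h4, h5, h6, h7, h8⟩ := h
  refine ⟨p2, p1, h2, h1, by linarith, h5, h4, h7, h6, ?_⟩
  simp only [Prod.fst_swap, Prod.snd_swap]
  rw [add_comm r.2, add_right_comm]
  exact h8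

lemma mem_gainRegion_of_le {k1 k2 P : ℝ} {r s : ℝ × ℝ} (h : r ∈ gainRegion k1 k2 P)
    (h1 : 0 ≤ s.1) (h2 : 0 ≤ s.2) (h1' : s.1 ≤ r.1) (h2' : s.2 ≤ r.2) :
    s ∈ gainRegion k1 k2 P := by
  obtain ⟨p1, p2, a1, a2, a3, -, -, a6, a7, a8⟩ := h
  exact ⟨p1, p2, a1, a2, a3, h1, h2, h1'.trans a6, h2'.trans a7, by linarith⟩

lemma one_le_two_rpow {r : ℝ} (h : 0 ≤ r) : (1 : ℝ) ≤ 2 ^ r :=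
  Real.one_le_rpow (by norm_num) h

lemma mem_gainRegion_iff {k1 k2 P : ℝ} (hk1 : 0 < k1) (hk2 : 0 < k2) {r : ℝ × ℝ} :
    r ∈ gainRegion k1 k2 P ↔ 0 ≤ r.1 ∧ 0 ≤ r.2 ∧ powerCost k1 k2 r ≤ P := by
  have key : ∀ {k1 k2 : ℝ}, 0 < k1 → 0 < k2 → k2 ≤ k1 → ∀ r : ℝ × ℝ,
      (r ∈ gainRegion k1 k2 P ↔ 0 ≤ r.1 ∧ 0 ≤ r.2 ∧ powerCost k1 k2 r ≤ P) := by
    intro k1 k2 hk1 hk2 hle r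
    have hm : min k1⁻¹ k2⁻¹ = k1⁻¹ := min_eq_left (inv_anti₀ hk2 hle)
    unfold powerCost
    rw [hm]
    constructor
    · rintro ⟨p1, p2, a1, a2, a3, a4, a5, a6, a7, a8⟩
      refine ⟨a4, a5, ?_⟩
      have b1 := mul_nonneg a1 hk1.le
      have b2 := mul_nonneg a2 hk2.le
      rw [Real.le_logb_iff_rpow_le (by norm_num) (by linarith)] at a6 a7 a8
      rw [Real.rpow_add (by norm_num)] at a8
      have hu := one_le_two_rpow a4
      have hv := one_le_two_rpow a5
      generalize (2 : ℝ) ^ r.1 = u at *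
      generalize (2 : ℝ) ^ r.2 = v at *
      refine le_trans ?_ a3
      have e : (u - 1) * k1⁻¹ + (v - 1) * k2⁻¹ + (u - 1) * (v - 1) * k1⁻¹
          = ((u * v - 1) * k2 + (v - 1) * (k1 - k2)) / (k1 * k2) := by
        field_simp; ring
      rw [e, div_le_iff₀ (by positivity)]
      have c1 : (u * v - 1) * k2 ≤ (p1 * k1 + p2 * k2) * k2 :=
        mul_le_mul_of_nonneg_right (by linarith) hk2.le
      have c2 : (v - 1) * (k1 - k2) ≤ (p2 * k2) * (k1 - k2) :=
        mul_le_mul_of_nonneg_right (by linarith) (by linarith)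
      linarith
    · rintro ⟨a4, a5, h⟩
      have hu := one_le_two_rpow a4
      have hv := one_le_two_rpow a5
      have hu' : 0 ≤ (2 : ℝ) ^ r.1 - 1 := by linarith
      have hv' : 0 ≤ (2 : ℝ) ^ r.2 - 1 := by linarith
      have e1 : (2 : ℝ) ^ r.2 * (2 ^ r.1 - 1) * k1⁻¹ * k1 = 2 ^ r.2 * (2 ^ r.1 - 1) :=
        inv_mul_cancel_right₀ hk1.ne' _
      have e2 : ((2 : ℝ) ^ r.2 - 1) * k2⁻¹ * k2 = 2 ^ r.2 - 1 :=
        inv_mul_cancel_right₀ hk2.ne' _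
      refine ⟨2 ^ r.2 * (2 ^ r.1 - 1) * k1⁻¹, (2 ^ r.2 - 1) * k2⁻¹, by positivity,
        by positivity, by linarith, a4, a5, ?_, ?_, ?_⟩
      all_goals
        rw [Real.le_logb_iff_rpow_le (by norm_num) (by simp only [e1, e2]; positivity)]
        simp only [e1, e2]
      · nlinarith
      · linarith
      · rw [Real.rpow_add (by norm_num)]
        linarith
  rcases le_total k2 k1 with h | h
  · exact key hk1 hk2 h r
  · have e : r ∈ gainRegion k1 k2 P ↔ r.swap ∈ gainRegion k2 k1 P :=
      ⟨mem_gainRegion_swap, fun h => by simpa using mem_gainRegion_swap h⟩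
    rw [e, key hk2 hk1 h]
    have : powerCost k2 k1 r.swap = powerCost k1 k2 r := by
      simp only [powerCost, Prod.fst_swap, Prod.snd_swap, min_comm k2⁻¹]
      ring
    rw [this]
    simp only [Prod.fst_swap, Prod.snd_swap]
    tauto

lemma isClosed_gainRegion {k1 k2 : ℝ} (P : ℝ) (hk1 : 0 < k1) (hk2 : 0 < k2) :
    IsClosed (gainRegion k1 k2 P) := by
  have : gainRegion k1 k2 P = {r | 0 ≤ r.1} ∩ ({r | 0 ≤ r.2} ∩ {r | powerCost k1 k2 r ≤ P}) := by
    ext r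
    exact mem_gainRegion_iff hk1 hk2
  rw [this]
  have hc : Continuous (powerCost k1 k2) := by
    have c : Continuous fun x : ℝ => (2 : ℝ) ^ x := Real.continuous_const_rpow (by norm_num)
    have c1 := c.comp (continuous_fst (X := ℝ) (Y := ℝ))
    have c2 := c.comp (continuous_snd (X := ℝ) (Y := ℝ))
    simp only [Function.comp_def] at c1 c2
    unfold powerCost
    fun_prop
  exact (isClosed_le continuous_const continuous_fst).inter
    ((isClosed_le continuous_const continuous_snd).inter (isClosed_le hc continuous_const))

lemma logb_two_concave {x y a b : ℝ} (hx : 0 < x) (hy : 0 < y) (ha : 0 ≤ a) (hb : 0 ≤ b)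
    (hab : a + b = 1) :
    a * Real.logb 2 x + b * Real.logb 2 y ≤ Real.logb 2 (a * x + b * y) := by
  have h := strictConcaveOn_log_Ioi.concaveOn.2 (Set.mem_Ioi.2 hx) (Set.mem_Ioi.2 hy) ha hb hab
  simp only [smul_eq_mul] at h
  simp only [Real.logb, ← mul_div_assoc, ← add_div]
  exact div_le_div_of_nonneg_right h (Real.log_nonneg (by norm_num))

lemma convex_gainRegion {k1 k2 : ℝ} (P : ℝ) (hk1 : 0 < k1) (hk2 : 0 < k2) :
    Convex ℝ (gainRegion k1 k2 P) := by
  rintro r ⟨p1, p2, a1, a2, a3, a4, a5, a6, a7, a8⟩ s ⟨q1, q2, b1, b2, b3, b4, b5, b6, b7, b8⟩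
    a b ha hb hab
  have scale : ∀ {u v u' v' : ℝ}, u ≤ u' → v ≤ v' → a * u + b * v ≤ a * u' + b * v' :=
    fun h h' => add_le_add (mul_le_mul_of_nonneg_left h ha) (mul_le_mul_of_nonneg_left h' hb)
  have hb' : b = 1 - a := by linarith
  refine ⟨a * p1 + b * q1, a * p2 + b * q2, by positivity, by positivity, ?_, ?_, ?_, ?_, ?_, ?_⟩
  · have := scale a3 b3
    rw [← add_mul, hab] at this
    linarith
  · simp only [Prod.fst_add, Prod.smul_fst, smul_eq_mul]; positivity
  · simp only [Prod.snd_add, Prod.smul_snd, smul_eq_mul]; positivity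
  · refine ((scale a6 b6).trans (logb_two_concave (by positivity) (by positivity) ha hb hab)).trans
      (le_of_eq ?_)
    congr 1; rw [hb']; ring
  · refine ((scale a7 b7).trans (logb_two_concave (by positivity) (by positivity) ha hb hab)).trans
      (le_of_eq ?_)
    congr 1; rw [hb']; ring
  · have := (scale a8 b8).trans (logb_two_concave (by positivity) (by positivity) ha hb hab)
    refine le_trans (le_of_eq ?_) (this.trans (le_of_eq ?_))
    · simp only [Prod.fst_add, Prod.smul_fst, Prod.snd_add, Prod.smul_snd, smul_eq_mul]; ring
    · congr 1; rw [hb']; ring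

lemma powerCost_exchange {g1 g2 m g1' g2' m' P a0 b0 a b : ℝ} (hg1 : 0 < g1) (hg2 : 0 < g2)
    (hm : 0 ≤ m) (hg1' : g1 < g1') (hg2' : g2' ≤ g2) (ha0 : 0 ≤ a0) (hb0 : 0 ≤ b0) (ha : 0 ≤ a)
    (hP : 0 < P) (hbb : b0 ≤ b) (h0 : a0 * g1 + b0 * g2 + a0 * b0 * m = P)
    (h0' : a0 * g1' + b0 * g2' + a0 * b0 * m' ≤ P) (h : a * g1 + b * g2 + a * b * m ≤ P) :
    a * g1' + b * g2' + a * b * m' ≤ P := by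
  have haa : a ≤ a0 := by
    by_contra! hlt
    have e1 : a0 * g1 < a * g1 := mul_lt_mul_of_pos_right hlt hg1
    have e2 : b0 * g2 ≤ b * g2 := mul_le_mul_of_nonneg_right hbb hg2.le
    have e3 : a0 * b0 * m ≤ a * b * m :=
      mul_le_mul_of_nonneg_right (mul_le_mul hlt.le hbb hb0 ha) hm
    linarith
  have hb0' : 0 < b0 := by
    rcases hb0.lt_or_eq with h | rfl
    · exact h
    · have : 0 < a0 := by
        rcases ha0.lt_or_eq with h | rfl
        · exact h
        · simp at h0; linarith
      have := mul_lt_mul_of_pos_left hg1' this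
      simp at h0 h0'
      linarith
  suffices a * (g1' - g1) + a * b * (m' - m) ≤ b * (g2 - g2') by linarith
  have hD : a0 * (g1' - g1) + a0 * b0 * (m' - m) ≤ b0 * (g2 - g2') := by linarith
  have hb : 0 < b := hb0'.trans_le hbb
  have hd : 0 < g1' - g1 := by linarith
  have e1 : b0 * a * (g1' - g1) ≤ b * a0 * (g1' - g1) :=
    mul_le_mul_of_nonneg_right (mul_le_mul hbb haa ha hb.le) hd.le
  have e2 := mul_le_mul_of_nonneg_left hD hb.le
  rcases le_total m m' with hmm | hmm
  · have e3 : a * (b * b0 * (m' - m)) ≤ a0 * (b * b0 * (m' - m)) :=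
      mul_le_mul_of_nonneg_right haa (mul_nonneg (by positivity) (by linarith))
    refine le_of_mul_le_mul_left ?_ hb0'
    linarith
  · have e3 : b0 * (g2 - g2') ≤ b * (g2 - g2') :=
      mul_le_mul_of_nonneg_right hbb (by linarith)
    rcases le_total (g1' - g1 + b * (m' - m)) 0 with hs | hs
    · have e4 := mul_nonpos_of_nonneg_of_nonpos ha hs
      have e5 : 0 ≤ b0 * (g2 - g2') := mul_nonneg hb0 (by linarith)
      linarith
    · have e4 := mul_le_mul_of_nonneg_right haa hs
      have e5 : b0 * (m - m') ≤ b * (m - m') := mul_le_mul_of_nonneg_right hbb (by linarith)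
      have e6 := mul_le_mul_of_nonneg_left e5 ha0
      linarith

lemma logb_one_add_mul_nonneg {p k : ℝ} (hp : 0 ≤ p) (hk : 0 ≤ k) :
    0 ≤ Real.logb 2 (1 + p * k) :=
  Real.logb_nonneg (by norm_num) (by nlinarith [mul_nonneg hp hk])

/-- Above the second rate of a point `b` of the second region that is not beaten by the first
region, the second region contains the first one. -/
lemma mem_gainRegion_of_snd_lt {k1 k2 l1 l2 P l m : ℝ} (hP : 0 < P) (hk2 : 0 < k2)
    (hl1 : 0 < l1) (h1 : l1 < k1) (h2 : k2 ≤ l2) (hl : 0 < l)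
    {b c : ℝ × ℝ} (hb : b ∈ gainRegion l1 l2 P) (hc : c ∈ gainRegion k1 k2 P)
    (hbelow : ∀ r ∈ gainRegion k1 k2 P, l * r.1 + m * r.2 ≤ l * b.1 + m * b.2)
    (hlt : b.2 < c.2) : c ∈ gainRegion l1 l2 P := by
  have hk1 : 0 < k1 := hl1.trans h1
  have hl2 : 0 < l2 := hk2.trans_le h2
  have hb' := (mem_gainRegion_iff hl1 hl2).1 hb
  have hc' := (mem_gainRegion_iff hk1 hk2).1 hc
  have ha := one_le_two_rpow hc'.1
  have hv := one_le_two_rpow hc'.2.1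
  have hv0 := one_le_two_rpow hb'.2.1
  have hvv : (2 : ℝ) ^ b.2 ≤ 2 ^ c.2 := Real.rpow_le_rpow_of_exponent_le (by norm_num) hlt.le
  have hg1 : 0 < k1⁻¹ := inv_pos.2 hk1
  have hg2 : 0 < k2⁻¹ := inv_pos.2 hk2
  have hm0 : 0 < min k1⁻¹ k2⁻¹ := lt_min hg1 hg2
  set β : ℝ := 2 ^ b.2 - 1 with hβ
  have hβ0 : 0 ≤ β := by linarith
  have hden : 0 < k1⁻¹ + β * min k1⁻¹ k2⁻¹ := by positivity
  have hnum : 0 ≤ P - β * k2⁻¹ := by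
    have e := hc'.2.2
    unfold powerCost at e
    have e1 : β * k2⁻¹ ≤ (2 ^ c.2 - 1) * k2⁻¹ :=
      mul_le_mul_of_nonneg_right (by linarith) hg2.le
    have e2 : 0 ≤ ((2 : ℝ) ^ c.1 - 1) * k1⁻¹ := mul_nonneg (by linarith) hg1.le
    have e3 : 0 ≤ ((2 : ℝ) ^ c.1 - 1) * (2 ^ c.2 - 1) * min k1⁻¹ k2⁻¹ :=
      mul_nonneg (mul_nonneg (by linarith) (by linarith)) hm0.le
    linarith
  set a0 := (P - β * k2⁻¹) / (k1⁻¹ + β * min k1⁻¹ k2⁻¹) with ha0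
  have ha00 : 0 ≤ a0 := div_nonneg hnum hden.le
  have heq : a0 * (k1⁻¹ + β * min k1⁻¹ k2⁻¹) = P - β * k2⁻¹ := div_mul_cancel₀ _ hden.ne'
  have hpow : (2 : ℝ) ^ Real.logb 2 (1 + a0) = 1 + a0 :=
    Real.rpow_logb (by norm_num) (by norm_num) (by linarith)
  have hα : 0 ≤ Real.logb 2 (1 + a0) := Real.logb_nonneg (by norm_num) (by linarith)
  have hmem : (Real.logb 2 (1 + a0), b.2) ∈ gainRegion k1 k2 P := by
    refine (mem_gainRegion_iff hk1 hk2).2 ⟨hα, hb'.2.1, le_of_eq ?_⟩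
    simp only [powerCost, hpow, ← hβ]
    linarith
  have hle : Real.logb 2 (1 + a0) ≤ b.1 := by
    have := hbelow _ hmem
    exact le_of_mul_le_mul_left (by simpa using this) hl
  have hmem' := ((mem_gainRegion_iff hl1 hl2).1
    (mem_gainRegion_of_le (s := (Real.logb 2 (1 + a0), b.2)) hb hα hb'.2.1 hle le_rfl)).2.2
  simp only [powerCost, hpow, ← hβ] at hmem'
  refine (mem_gainRegion_iff hl1 hl2).2 ⟨hc'.1, hc'.2.1, ?_⟩
  have hc'' := hc'.2.2
  unfold powerCost at hc'' ⊢
  exact powerCost_exchange (a0 := a0) (b0 := β) hg1 hg2 hm0.le (inv_strictAnti₀ hl1 h1)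
    (inv_anti₀ hk2 h2) ha00 hβ0 (by linarith) hP (by linarith) (by linarith) (by linarith) hc''

lemma mem_convexHull_of_le {k1 k2 l1 l2 P : ℝ} {z c : ℝ × ℝ}
    (hz : z ∈ convexHull ℝ (gainRegion k1 k2 P ∪ gainRegion l1 l2 P))
    (hc1 : 0 ≤ c.1) (hc2 : 0 ≤ c.2) (h1 : c.1 ≤ z.1) (h2 : c.2 ≤ z.2) :
    c ∈ convexHull ℝ (gainRegion k1 k2 P ∪ gainRegion l1 l2 P) := by
  have scale : ∀ x y : ℝ, 0 ≤ x → x ≤ y → ∃ u, 0 ≤ u ∧ u ≤ 1 ∧ u * y = x := by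
    intro x y hx hxy
    rcases (hx.trans hxy).lt_or_eq with h | h
    · exact ⟨x / y, by positivity, (div_le_one h).2 hxy, div_mul_cancel₀ _ h.ne'⟩
    · exact ⟨0, le_rfl, zero_le_one, by linarith⟩
  obtain ⟨u, hu0, hu1, hu⟩ := scale _ _ hc1 h1
  obtain ⟨v, hv0, hv1, hv⟩ := scale _ _ hc2 h2
  let f : ℝ × ℝ →ₗ[ℝ] ℝ × ℝ := LinearMap.prodMap (u • LinearMap.id) (v • LinearMap.id)
  have hf : f z = c := Prod.ext (by simpa [f] using hu) (by simpa [f] using hv)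
  have hreg : ∀ {k1 k2 : ℝ}, ∀ r ∈ gainRegion k1 k2 P, f r ∈ gainRegion k1 k2 P := by
    intro k1 k2 r hr
    obtain ⟨-, -, -, -, -, hr1, hr2, -⟩ := id hr
    refine mem_gainRegion_of_le hr ?_ ?_ ?_ ?_
    · simpa [f] using mul_nonneg hu0 hr1
    · simpa [f] using mul_nonneg hv0 hr2
    · simpa [f] using mul_le_of_le_one_left hr1 hu1
    · simpa [f] using mul_le_of_le_one_left hr2 hv1
  have : f z ∈ f '' convexHull ℝ (gainRegion k1 k2 P ∪ gainRegion l1 l2 P) := ⟨z, hz, rfl⟩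
  rw [f.image_convexHull, hf] at this
  refine convexHull_mono ?_ this
  rintro _ ⟨r, hr | hr, rfl⟩
  · exact Or.inl (hreg r hr)
  · exact Or.inr (hreg r hr)

lemma gainRegion_subset_convexHull {k1 k2 i1 i2 j1 j2 P l m : ℝ} (hP : 0 < P) (hi2 : 0 < i2)
    (hj1 : 0 < j1) (hik1 : k1 < i1) (hki2 : i2 < k2) (hjk1 : j1 < k1) (hkj2 : k2 < j2)
    (hl : 0 ≤ l) (hm : 0 ≤ m) (hlm : 0 < l + m) {b b' : ℝ × ℝ}
    (hb : b ∈ gainRegion i1 i2 P) (hb' : b' ∈ gainRegion j1 j2 P)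
    (hle : ∀ r ∈ gainRegion k1 k2 P, l * r.1 + m * r.2 ≤ l * b.1 + m * b.2)
    (hle' : ∀ r ∈ gainRegion k1 k2 P, l * r.1 + m * r.2 ≤ l * b'.1 + m * b'.2) :
    gainRegion k1 k2 P ⊆ convexHull ℝ (gainRegion i1 i2 P ∪ gainRegion j1 j2 P) := by
  have hk1 : 0 < k1 := hj1.trans hjk1
  have hk2 : 0 < k2 := hi2.trans hki2
  have lpos : 0 < l := by
    rcases hl.lt_or_eq with h | rfl
    · exact h
    exfalso
    have hmem : (0, Real.logb 2 (1 + P * k2)) ∈ gainRegion k1 k2 P :=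
      ⟨0, P, le_rfl, hP.le, by simp, le_rfl, logb_one_add_mul_nonneg hP.le hk2.le, by simp,
        by simp, by simp⟩
    have h1 := hle _ hmem
    obtain ⟨p1, p2, a1, a2, a3, -, -, -, a7, -⟩ := hb
    have h2 : Real.logb 2 (1 + P * k2) ≤ b.2 :=
      le_of_mul_le_mul_left (by simpa using h1) (by linarith : 0 < m)
    have h3 : Real.logb 2 (1 + p2 * i2) < Real.logb 2 (1 + P * k2) := by
      refine Real.logb_lt_logb (by norm_num) (by positivity) ?_
      have := mul_le_mul_of_nonneg_right (by linarith : p2 ≤ P) hi2.le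
      have := mul_lt_mul_of_pos_left hki2 hP
      linarith
    linarith
  have mpos : 0 < m := by
    rcases hm.lt_or_eq with h | rfl
    · exact h
    exfalso
    have hmem : (Real.logb 2 (1 + P * k1), 0) ∈ gainRegion k1 k2 P :=
      ⟨P, 0, hP.le, le_rfl, by simp, logb_one_add_mul_nonneg hP.le hk1.le, le_rfl, by simp,
        by simp, by simp⟩
    have h1 := hle' _ hmem
    obtain ⟨p1, p2, a1, a2, a3, -, -, a6, -, -⟩ := hb'
    have h2 : Real.logb 2 (1 + P * k1) ≤ b'.1 :=
      le_of_mul_le_mul_left (by simpa using h1) lpos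
    have h3 : Real.logb 2 (1 + p1 * j1) < Real.logb 2 (1 + P * k1) := by
      refine Real.logb_lt_logb (by norm_num) (by positivity) ?_
      have := mul_le_mul_of_nonneg_right (by linarith : p1 ≤ P) hj1.le
      have := mul_lt_mul_of_pos_left hjk1 hP
      linarith
    linarith
  intro c hc
  obtain ⟨-, -, -, -, -, hc1, hc2, -⟩ := id hc
  rcases lt_or_ge b'.2 c.2 with h | hcb'
  · exact subset_convexHull ℝ _
      (Or.inr (mem_gainRegion_of_snd_lt hP hk2 hj1 hjk1 hkj2.le lpos hb' hc hle' h))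
  rcases lt_or_ge b.1 c.1 with h | hcb
  · refine subset_convexHull ℝ _ (Or.inl ?_)
    have := mem_gainRegion_of_snd_lt (m := l) hP hk1 hi2 hki2 hik1.le mpos
      (mem_gainRegion_swap hb) (mem_gainRegion_swap hc) (fun r hr => ?_) h
    · simpa using mem_gainRegion_swap this
    · have := hle _ (mem_gainRegion_swap hr)
      simp only [Prod.fst_swap, Prod.snd_swap] at this ⊢
      linarith
  rcases le_or_gt c.2 b.2 with h | hbc2
  · exact subset_convexHull ℝ _ (Or.inl (mem_gainRegion_of_le hb hc1 hc2 hcb h))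
  rcases le_or_gt c.1 b'.1 with h | hbc1
  · exact subset_convexHull ℝ _ (Or.inr (mem_gainRegion_of_le hb' hc1 hc2 h hcb'))
  have hd : 0 < b.1 - b'.1 := by linarith
  set θ := (c.1 - b'.1) / (b.1 - b'.1) with hθ
  have hθ0 : 0 ≤ θ := div_nonneg (by linarith) hd.le
  have hθ1 : θ ≤ 1 := (div_le_one hd).2 (by linarith)
  have hθe : θ * (b.1 - b'.1) = c.1 - b'.1 := div_mul_cancel₀ _ hd.ne'
  have hz : θ • b + (1 - θ) • b' ∈
      convexHull ℝ (gainRegion i1 i2 P ∪ gainRegion j1 j2 P) :=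
    (convex_convexHull ℝ (gainRegion i1 i2 P ∪ gainRegion j1 j2 P)) (subset_convexHull ℝ _ (Or.inl hb))
      (subset_convexHull ℝ _ (Or.inr hb')) hθ0 (sub_nonneg.2 hθ1) (add_sub_cancel θ 1)
  have hz1 : c.1 = θ * b.1 + (1 - θ) * b'.1 := by linarith
  have hlc : l * c.1 + m * c.2 ≤
      θ * (l * b.1 + m * b.2) + (1 - θ) * (l * b'.1 + m * b'.2) := by
    have e1 := mul_le_mul_of_nonneg_left (hle c hc) hθ0
    have e2 := mul_le_mul_of_nonneg_left (hle' c hc) (sub_nonneg.2 hθ1)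
    linarith
  refine mem_convexHull_of_le hz hc1 hc2 (le_of_eq ?_) ?_
  · simpa using hz1
  · simp only [Prod.snd_add, Prod.smul_snd, smul_eq_mul]
    rw [hz1] at hlc
    refine le_of_mul_le_mul_left ?_ mpos
    linarith

/-- If no point of a convex set strictly dominates a point of the segment from `b` to `b'`, then
some nonnegative weights separate the set from both `b` and `b'`. -/
lemma exists_weights_of_not_dominated {C : Set (ℝ × ℝ)} (hC : Convex ℝ C) (hne : C.Nonempty)
    {b b' : ℝ × ℝ}
    (h : ∀ θ : ℝ, 0 ≤ θ → θ ≤ 1 → ∀ c ∈ C, ¬ (θ * b.1 + (1 - θ) * b'.1 < c.1 ∧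
      θ * b.2 + (1 - θ) * b'.2 < c.2)) :
    ∃ l m : ℝ, 0 ≤ l ∧ 0 ≤ m ∧ 0 < l + m ∧
      (∀ r ∈ C, l * r.1 + m * r.2 ≤ l * b.1 + m * b.2) ∧
      (∀ r ∈ C, l * r.1 + m * r.2 ≤ l * b'.1 + m * b'.2) := by
  set U : Set (ℝ × ℝ) := ⋃ c ∈ C, Set.Iio c.1 ×ˢ Set.Iio c.2 with hU
  have memU : ∀ z, z ∈ U ↔ ∃ c ∈ C, z.1 < c.1 ∧ z.2 < c.2 := by
    intro z; simp only [hU, Set.mem_iUnion, Set.mem_prod, Set.mem_Iio, exists_prop]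
  have hUo : IsOpen U := isOpen_biUnion fun c _ => isOpen_Iio.prod isOpen_Iio
  have hUc : Convex ℝ U := by
    intro x hx y hy s t hs ht hst
    obtain ⟨c, hc, hc1, hc2⟩ := (memU x).1 hx
    obtain ⟨d, hd, hd1, hd2⟩ := (memU y).1 hy
    have comb : ∀ {u v u' v' : ℝ}, u < u' → v < v' → s * u + t * v < s * u' + t * v' := by
      intro u v u' v' h h'
      rcases hs.lt_or_eq with h0 | h0
      · exact add_lt_add_of_lt_of_le (mul_lt_mul_of_pos_left h h0)
          (mul_le_mul_of_nonneg_left h'.le ht)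
      · have : t = 1 := by linarith
        subst this
        rw [← h0]; linarith
    exact (memU _).2 ⟨s • c + t • d, hC hc hd hs ht hst, by simpa using comb hc1 hd1,
      by simpa using comb hc2 hd2⟩
  have hdisj : Disjoint U (segment ℝ b b') := by
    rw [Set.disjoint_left]
    rintro z hz ⟨s, t, hs, ht, hst, rfl⟩
    obtain ⟨c, hc, hc1, hc2⟩ := (memU _).1 hz
    have : t = 1 - s := by linarith
    subst this
    exact h s hs (by linarith) c hc ⟨by simpa using hc1, by simpa using hc2⟩
  obtain ⟨f, u, hfU, hfS⟩ := geometric_hahn_banach_open hUc hUo (convex_segment b b') hdisj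
  have hf : ∀ z : ℝ × ℝ, f z = f (1, 0) * z.1 + f (0, 1) * z.2 := by
    intro z
    have : z = z.1 • ((1, 0) : ℝ × ℝ) + z.2 • ((0, 1) : ℝ × ℝ) := by ext <;> simp
    conv_lhs => rw [this]
    simp only [map_add, map_smul, smul_eq_mul]
    ring
  obtain ⟨c₀, hc₀⟩ := hne
  have hlt : ∀ c ∈ C, ∀ s t : ℝ, 0 < s → 0 < t →
      f (1, 0) * (c.1 - s) + f (0, 1) * (c.2 - t) < u := by
    intro c hc s t hs ht
    have := hfU (c.1 - s, c.2 - t) ((memU _).2 ⟨c, hc, by simpa using hs, by simpa using ht⟩)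
    rwa [hf] at this
  have hleC : ∀ c ∈ C, f (1, 0) * c.1 + f (0, 1) * c.2 ≤ u := by
    intro c hc
    have ht : Filter.Tendsto (fun s : ℝ => f (1, 0) * (c.1 - s) + f (0, 1) * (c.2 - s))
        (nhdsWithin 0 (Set.Ioi 0)) (nhds (f (1, 0) * (c.1 - 0) + f (0, 1) * (c.2 - 0))) :=
      (Continuous.tendsto (by fun_prop) 0).mono_left nhdsWithin_le_nhds
    simp only [sub_zero] at ht
    exact le_of_tendsto ht (eventually_nhdsWithin_of_forall fun s hs => (hlt c hc s s hs hs).le)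
  have hb := hfS b (left_mem_segment ℝ b b')
  have hb' := hfS b' (right_mem_segment ℝ b b')
  rw [hf] at hb hb'
  set l := f (1, 0)
  set m := f (0, 1)
  have nonneg : ∀ {x A : ℝ}, (∀ s : ℝ, 0 < s → A - x * s < u) → 0 ≤ x := by
    intro x A hx
    by_contra! hneg
    have e := hx ((|u - A| + 1) / (-x)) (div_pos (by positivity) (by linarith))
    have e2 : x * ((|u - A| + 1) / (-x)) = -(|u - A| + 1) := by
      rw [div_neg, mul_neg, mul_div_cancel₀ _ hneg.ne]
    rw [e2] at e
    linarith [le_abs_self (u - A)]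
  have hl : 0 ≤ l := nonneg (A := l * c₀.1 + m * (c₀.2 - 1)) fun s hs => by
    linarith [hlt c₀ hc₀ s 1 hs one_pos]
  have hm : 0 ≤ m := nonneg (A := l * (c₀.1 - 1) + m * c₀.2) fun s hs => by
    linarith [hlt c₀ hc₀ 1 s one_pos hs]
  refine ⟨l, m, hl, hm, ?_, fun r hr => (hleC r hr).trans hb, fun r hr => (hleC r hr).trans hb'⟩
  by_contra! h0
  have hl0 : l = 0 := by linarith
  have hm0 : m = 0 := by linarith
  have e := hlt c₀ hc₀ 1 1 one_pos one_pos
  rw [hl0, hm0] at e hb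
  linarith

section Gains

variable {D H β0 : ℝ}

lemma h1_pos (hH : 0 < H) (hβ : 0 < β0) (x : ℝ) : 0 < h1 D H β0 x := by
  unfold h1; positivity

lemma h2_pos (hH : 0 < H) (hβ : 0 < β0) (x : ℝ) : 0 < h2 D H β0 x := by
  unfold h2; positivity

lemma h1_le (hH : 0 < H) (hβ : 0 < β0) (x : ℝ) : h1 D H β0 x ≤ β0 / H ^ 2 :=
  div_le_div_of_nonneg_left hβ.le (by positivity) (by nlinarith [sq_nonneg (x + D / 2)])

lemma h2_le (hH : 0 < H) (hβ : 0 < β0) (x : ℝ) : h2 D H β0 x ≤ β0 / H ^ 2 :=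
  div_le_div_of_nonneg_left hβ.le (by positivity) (by nlinarith [sq_nonneg (x - D / 2)])

lemma continuous_h1 (hH : 0 < H) : Continuous (h1 D H β0) := by
  unfold h1
  exact continuous_const.div (by fun_prop) fun x => by positivity

lemma continuous_h2 (hH : 0 < H) : Continuous (h2 D H β0) := by
  unfold h2
  exact continuous_const.div (by fun_prop) fun x => by positivity

lemma h1_lt_h1 (hH : 0 < H) (hβ : 0 < β0) {x y : ℝ} (hx : -(D / 2) ≤ x) (hxy : x < y) :
    h1 D H β0 y < h1 D H β0 x :=
  div_lt_div_of_pos_left hβ (by positivity) (by nlinarith)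

lemma h2_lt_h2 (hH : 0 < H) (hβ : 0 < β0) {x y : ℝ} (hy : y ≤ D / 2) (hxy : x < y) :
    h2 D H β0 x < h2 D H β0 y :=
  div_lt_div_of_pos_left hβ (by positivity) (by nlinarith)

end Gains

lemma FeasibleTraj.continuousOn {V T : ℝ} {x : ℝ → ℝ} (hx : FeasibleTraj V T x) :
    ContinuousOn x (Set.Icc 0 T) := by
  refine LipschitzOnWith.continuousOn (K := V.toNNReal)
    (LipschitzOnWith.of_dist_le_mul fun s hs t ht => ?_)
  rw [Real.dist_eq, Real.dist_eq]
  exact (hx s hs t ht).trans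
    (mul_le_mul_of_nonneg_right (Real.le_coe_toNNReal V) (abs_nonneg _))

/-- The rates `r1`, `r2` are supported by powers `p1`, `p2` at gains `k1`, `k2` within the
budget `P`. -/
def Supports (P k1 k2 p1 p2 r1 r2 : ℝ) : Prop :=
  0 ≤ p1 ∧ 0 ≤ p2 ∧ p1 + p2 ≤ P ∧ r1 ≤ Real.logb 2 (1 + p1 * k1) ∧
    r2 ≤ Real.logb 2 (1 + p2 * k2) ∧ r1 + r2 ≤ Real.logb 2 (1 + p1 * k1 + p2 * k2)

lemma intervalIntegrable_logb {T M : ℝ} (hT : 0 ≤ T) {f : ℝ → ℝ}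
    (hf : AEMeasurable f (volume.restrict (Set.Icc 0 T)))
    (h0 : ∀ t ∈ Set.Icc 0 T, 0 ≤ f t) (hM : ∀ t ∈ Set.Icc 0 T, f t ≤ M) :
    IntervalIntegrable (fun t => Real.logb 2 (1 + f t)) volume 0 T := by
  rw [intervalIntegrable_iff_integrableOn_Icc_of_le hT]
  refine Integrable.of_bound ?_ (Real.logb 2 (1 + M)) ?_
  · exact ((Real.measurable_log.comp_aemeasurable (hf.const_add 1)).div_const
      (Real.log 2)).aestronglyMeasurable
  · refine (ae_restrict_iff' measurableSet_Icc).2 (Filter.Eventually.of_forall fun t ht => ?_)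
    have h1 := h0 t ht
    rw [Real.norm_of_nonneg (Real.logb_nonneg (by norm_num) (by linarith))]
    exact Real.logb_le_logb_of_le (by norm_num) (by linarith) (by linarith [hM t ht])

section Rates

variable {D H β0 P V T : ℝ} {x p1 p2 : ℝ → ℝ}

lemma FeasiblePower.mul_h1_mem (hH : 0 < H) (hβ : 0 < β0) (hp : FeasiblePower P T p1 p2)
    {t : ℝ} (ht : t ∈ Set.Icc 0 T) :
    0 ≤ p1 t * h1 D H β0 (x t) ∧ p1 t * h1 D H β0 (x t) ≤ P * (β0 / H ^ 2) := by
  obtain ⟨a, b, c⟩ := hp.2.2 t ht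
  exact ⟨mul_nonneg a (h1_pos hH hβ _).le,
    mul_le_mul (by linarith) (h1_le hH hβ _) (h1_pos hH hβ _).le (by linarith)⟩

lemma FeasiblePower.mul_h2_mem (hH : 0 < H) (hβ : 0 < β0) (hp : FeasiblePower P T p1 p2)
    {t : ℝ} (ht : t ∈ Set.Icc 0 T) :
    0 ≤ p2 t * h2 D H β0 (x t) ∧ p2 t * h2 D H β0 (x t) ≤ P * (β0 / H ^ 2) := by
  obtain ⟨a, b, c⟩ := hp.2.2 t ht
  exact ⟨mul_nonneg b (h2_pos hH hβ _).le,
    mul_le_mul (by linarith) (h2_le hH hβ _) (h2_pos hH hβ _).le (by linarith)⟩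

lemma intervalIntegrable_rates (hH : 0 < H) (hβ : 0 < β0) (hT : 0 ≤ T)
    (hx : FeasibleTraj V T x) (hp : FeasiblePower P T p1 p2) :
    IntervalIntegrable (fun t => Real.logb 2 (1 + p1 t * h1 D H β0 (x t))) volume 0 T ∧
    IntervalIntegrable (fun t => Real.logb 2 (1 + p2 t * h2 D H β0 (x t))) volume 0 T ∧
    IntervalIntegrable (fun t => Real.logb 2
      (1 + p1 t * h1 D H β0 (x t) + p2 t * h2 D H β0 (x t))) volume 0 T := by
  have m1 : AEMeasurable (fun t => p1 t * h1 D H β0 (x t)) (volume.restrict (Set.Icc 0 T)) :=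
    hp.1.aemeasurable.mul (((continuous_h1 hH).comp_continuousOn hx.continuousOn).aemeasurable
      measurableSet_Icc)
  have m2 : AEMeasurable (fun t => p2 t * h2 D H β0 (x t)) (volume.restrict (Set.Icc 0 T)) :=
    hp.2.1.aemeasurable.mul (((continuous_h2 hH).comp_continuousOn hx.continuousOn).aemeasurable
      measurableSet_Icc)
  have b1 := fun t (ht : t ∈ Set.Icc 0 T) => hp.mul_h1_mem (D := D) (x := x) hH hβ ht
  have b2 := fun t (ht : t ∈ Set.Icc 0 T) => hp.mul_h2_mem (D := D) (x := x) hH hβ ht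
  refine ⟨intervalIntegrable_logb hT m1 (fun t ht => (b1 t ht).1) fun t ht => (b1 t ht).2,
    intervalIntegrable_logb hT m2 (fun t ht => (b2 t ht).1) fun t ht => (b2 t ht).2, ?_⟩
  simp only [add_assoc]
  exact intervalIntegrable_logb hT (m1.add m2) (fun t ht => add_nonneg (b1 t ht).1 (b2 t ht).1)
    fun t ht => add_le_add (b1 t ht).2 (b2 t ht).2

lemma achievable_of_supports (hH : 0 < H) (hβ : 0 < β0) (hT : 0 < T)
    (hx : FeasibleTraj V T x) (hp : FeasiblePower P T p1 p2) {r1 r2 : ℝ → ℝ}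
    (hr1 : IntervalIntegrable r1 volume 0 T) (hr2 : IntervalIntegrable r2 volume 0 T)
    (hr : ∀ t ∈ Set.Icc 0 T,
      Supports P (h1 D H β0 (x t)) (h2 D H β0 (x t)) (p1 t) (p2 t) (r1 t) (r2 t))
    {R1 R2 : ℝ} (hR1 : 0 ≤ R1) (hR2 : 0 ≤ R2) (h1 : R1 * T ≤ ∫ t in (0 : ℝ)..T, r1 t)
    (h2 : R2 * T ≤ ∫ t in (0 : ℝ)..T, r2 t) : Achievable D H β0 T x p1 p2 R1 R2 := by
  obtain ⟨i1, i2, i3⟩ := intervalIntegrable_rates (D := D) hH hβ hT.le hx hp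
  have key : ∀ {R I : ℝ}, R * T ≤ I → R ≤ 1 / T * I := by
    intro R I h
    rw [one_div_mul_eq_div]
    exact (le_div_iff₀ hT).2 h
  refine ⟨hR1, hR2, key (h1.trans ?_), key (h2.trans ?_), key ?_⟩
  · exact intervalIntegral.integral_mono_on hT.le hr1 i1 fun t ht => (hr t ht).2.2.2.1
  · exact intervalIntegral.integral_mono_on hT.le hr2 i2 fun t ht => (hr t ht).2.2.2.2.1
  · rw [add_mul]
    refine (add_le_add h1 h2).trans ?_
    rw [← intervalIntegral.integral_add hr1 hr2]
    exact intervalIntegral.integral_mono_on hT.le (hr1.add hr2) i3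
      fun t ht => (hr t ht).2.2.2.2.2

lemma Achievable.exists_supports (hH : 0 < H) (hβ : 0 < β0) (hT : 0 < T)
    (hx : FeasibleTraj V T x) (hp : FeasiblePower P T p1 p2) {R1 R2 : ℝ}
    (h : Achievable D H β0 T x p1 p2 R1 R2) :
    ∃ r1 r2 : ℝ → ℝ, IntervalIntegrable r1 volume 0 T ∧ IntervalIntegrable r2 volume 0 T ∧
      (∀ t ∈ Set.Icc 0 T, 0 ≤ r1 t ∧ 0 ≤ r2 t ∧
        Supports P (h1 D H β0 (x t)) (h2 D H β0 (x t)) (p1 t) (p2 t) (r1 t) (r2 t)) ∧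
      R1 * T ≤ ∫ t in (0 : ℝ)..T, r1 t ∧ R2 * T ≤ ∫ t in (0 : ℝ)..T, r2 t := by
  obtain ⟨i1, i2, i3⟩ := intervalIntegrable_rates (D := D) hH hβ hT.le hx hp
  obtain ⟨-, -, hR1, hR2, hR⟩ := h
  have b1 := fun t (ht : t ∈ Set.Icc 0 T) => hp.mul_h1_mem (D := D) (x := x) hH hβ ht
  have b2 := fun t (ht : t ∈ Set.Icc 0 T) => hp.mul_h2_mem (D := D) (x := x) hH hβ ht
  set L1 := fun t => Real.logb 2 (1 + p1 t * h1 D H β0 (x t)) with hL1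
  set L2 := fun t => Real.logb 2 (1 + p2 t * h2 D H β0 (x t)) with hL2
  set L := fun t => Real.logb 2 (1 + p1 t * h1 D H β0 (x t) + p2 t * h2 D H β0 (x t)) with hL
  have le1 : ∀ t ∈ Set.Icc 0 T, L1 t ≤ L t := fun t ht =>
    Real.logb_le_logb_of_le (by norm_num) (by linarith [(b1 t ht).1]) (by linarith [(b2 t ht).1])
  have le2 : ∀ t ∈ Set.Icc 0 T, L2 t ≤ L t := fun t ht =>
    Real.logb_le_logb_of_le (by norm_num) (by linarith [(b2 t ht).1]) (by linarith [(b1 t ht).1])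
  have sub : ∀ t ∈ Set.Icc 0 T, L t ≤ L1 t + L2 t := by
    intro t ht
    have c1 := (b1 t ht).1
    have c2 := (b2 t ht).1
    rw [hL1, hL2, hL]
    dsimp only
    rw [← Real.logb_mul (by linarith) (by linarith)]
    refine Real.logb_le_logb_of_le (by norm_num) (by linarith) ?_
    nlinarith [mul_nonneg c1 c2]
  have n1 : ∀ t ∈ Set.Icc 0 T, 0 ≤ L1 t := fun t ht =>
    Real.logb_nonneg (by norm_num) (by linarith [(b1 t ht).1])
  have n2 : ∀ t ∈ Set.Icc 0 T, 0 ≤ L2 t := fun t ht =>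
    Real.logb_nonneg (by norm_num) (by linarith [(b2 t ht).1])
  have key : ∀ {R I : ℝ}, R ≤ 1 / T * I → R * T ≤ I := by
    intro R I h
    rw [one_div_mul_eq_div] at h
    exact (le_div_iff₀ hT).1 h
  replace hR1 := key hR1
  replace hR2 := key hR2
  replace hR := key hR
  set A1 := ∫ t in (0 : ℝ)..T, L1 t
  set A2 := ∫ t in (0 : ℝ)..T, L2 t
  set A := ∫ t in (0 : ℝ)..T, L t
  obtain ⟨θ, h0, h1, e1, e2⟩ : ∃ θ : ℝ, 0 ≤ θ ∧ θ ≤ 1 ∧ R1 * T ≤ θ * A1 + (1 - θ) * (A - A2) ∧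
      R2 * T ≤ θ * (A - A1) + (1 - θ) * A2 := by
    rcases le_or_gt (R1 * T) (A - A2) with h | h
    · exact ⟨0, le_rfl, zero_le_one, by simpa using h, by simpa using hR2⟩
    · have hd : 0 < A1 - (A - A2) := by linarith
      have he : (R1 * T - (A - A2)) / (A1 - (A - A2)) * (A1 - (A - A2)) = R1 * T - (A - A2) :=
        div_mul_cancel₀ _ hd.ne'
      refine ⟨(R1 * T - (A - A2)) / (A1 - (A - A2)), div_nonneg (by linarith) hd.le,
        (div_le_one hd).2 (by linarith), by linarith, by linarith⟩
  refine ⟨fun t => θ * L1 t + (1 - θ) * (L t - L2 t), fun t => θ * (L t - L1 t) + (1 - θ) * L2 t,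
    (i1.const_mul θ).add ((i3.sub i2).const_mul _), ((i3.sub i1).const_mul _).add
      (i2.const_mul _), fun t ht => ?_, ?_, ?_⟩
  · have h1' : 0 ≤ 1 - θ := by linarith
    obtain ⟨q1, q2, q3⟩ := hp.2.2 t ht
    have := le1 t ht
    have := le2 t ht
    have := sub t ht
    have c1 := n1 t ht
    have c2 := n2 t ht
    have d1 := mul_nonneg h1' (by linarith : 0 ≤ L1 t + L2 t - L t)
    have d2 := mul_nonneg h0 (by linarith : 0 ≤ L1 t + L2 t - L t)
    refine ⟨add_nonneg (mul_nonneg h0 c1) (mul_nonneg h1' (by linarith)),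
      add_nonneg (mul_nonneg h0 (by linarith)) (mul_nonneg h1' c2), q1, q2, q3, ?_, ?_, ?_⟩
    · change _ ≤ L1 t
      linarith
    · change _ ≤ L2 t
      linarith
    · change _ ≤ L t
      linarith
  · rw [intervalIntegral.integral_add (i1.const_mul θ) ((i3.sub i2).const_mul _),
      intervalIntegral.integral_const_mul, intervalIntegral.integral_const_mul,
      intervalIntegral.integral_sub i3 i2]
    exact e1
  · rw [intervalIntegral.integral_add ((i3.sub i1).const_mul _) (i2.const_mul _),
      intervalIntegral.integral_const_mul, intervalIntegral.integral_const_mul,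
      intervalIntegral.integral_sub i3 i1]
    exact e2

end Rates

lemma average_mem_of_convex {s : Set (ℝ × ℝ)} (hs : Convex ℝ s) (hc : IsClosed s) {u v : ℝ}
    (huv : u < v) {r1 r2 : ℝ → ℝ} (h1 : IntervalIntegrable r1 volume u v)
    (h2 : IntervalIntegrable r2 volume u v) (h : ∀ t ∈ Set.Icc u v, (r1 t, r2 t) ∈ s) :
    ((∫ t in u..v, r1 t) / (v - u), (∫ t in u..v, r2 t) / (v - u)) ∈ s := by
  rw [intervalIntegrable_iff_integrableOn_Ioc_of_le huv.le] at h1 h2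
  have hmem := hs.set_average_mem (μ := volume) (t := Set.Ioc u v) hc
    (by simp [huv]) (by simp)
    ((ae_restrict_iff' measurableSet_Ioc).2
      (Filter.Eventually.of_forall fun t ht => h t (Set.Ioc_subset_Icc_self ht)))
    (Integrable.prodMk h1 h2)
  rw [setAverage_eq, integral_pair h1 h2] at hmem
  have hvol : volume.real (Set.Ioc u v) = v - u := by simp [huv.le]
  rw [hvol, ← intervalIntegral.integral_of_le huv.le,
    ← intervalIntegral.integral_of_le huv.le] at hmem
  simpa [div_eq_inv_mul] using hmem

/-- The function `f` with its values on `[0, a]` and `[T - b, T]` cut out and the constant `v`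
inserted at time `s` for a duration `a + b`; next to the cuts, what is left of `[0, δ]` and
`[T - δ, T]` is overwritten by the constants `u` and `w`. -/
noncomputable def splice (T s δ a b u v w : ℝ) (f : ℝ → ℝ) (t : ℝ) : ℝ :=
  if t ≤ δ - a then u else if t ≤ s - a then f (t + a) else if t ≤ s + b then v
  else if t ≤ T - δ + b then f (t - b) else w

section Splice

variable {T s δ a b u v w : ℝ} {f : ℝ → ℝ}

lemma measurable_splice (hf : Measurable f) : Measurable (splice T s δ a b u v w f) := by
  unfold splice
  refine Measurable.ite measurableSet_Iic measurable_const
    (Measurable.ite measurableSet_Iic (hf.comp (measurable_id.add_const a))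
      (Measurable.ite measurableSet_Iic measurable_const
        (Measurable.ite measurableSet_Iic (hf.comp (measurable_id.sub_const b))
          measurable_const)))

lemma integral_splice (ha : 0 ≤ a) (hb : 0 ≤ b) (haδ : a ≤ δ) (hbδ : b ≤ δ) (hs : δ ≤ s)
    (hsT : s ≤ T - δ) (hf : IntervalIntegrable f volume 0 T) :
    IntervalIntegrable (splice T s δ a b u v w f) volume 0 T ∧
    ∫ t in (0 : ℝ)..T, splice T s δ a b u v w f t =
      (δ - a) * u + (∫ t in δ..(T - δ), f t) + (a + b) * v + (δ - b) * w := by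
  have hf' : ∀ {c d : ℝ}, 0 ≤ c → c ≤ d → d ≤ T → IntervalIntegrable f volume c d := by
    intro c d h1 h2 h3
    refine hf.mono_set ?_
    rw [Set.uIcc_of_le h2, Set.uIcc_of_le (h1.trans (h2.trans h3))]
    exact Set.Icc_subset_Icc h1 h3
  have piece : ∀ {c d : ℝ} {g : ℝ → ℝ}, c ≤ d → IntervalIntegrable g volume c d →
      (∀ t ∈ Set.Ioc c d, splice T s δ a b u v w f t = g t) →
      IntervalIntegrable (splice T s δ a b u v w f) volume c d ∧
      ∫ t in c..d, splice T s δ a b u v w f t = ∫ t in c..d, g t := by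
    intro c d g hcd hg h
    constructor
    · refine hg.congr ?_
      rw [Set.uIoc_of_le hcd]
      intro t ht
      exact (h t ht).symm
    · refine intervalIntegral.integral_congr_ae (Filter.Eventually.of_forall fun t ht => ?_)
      rw [Set.uIoc_of_le hcd] at ht
      exact h t ht
  have g2 : IntervalIntegrable (fun t => f (t + a)) volume (δ - a) (s - a) :=
    (hf' (by linarith) hs (by linarith)).comp_add_right a
  have g4 : IntervalIntegrable (fun t => f (t - b)) volume (s + b) (T - δ + b) :=
    (hf' (by linarith) hsT (by linarith)).comp_sub_right b
  obtain ⟨i1, e1⟩ := piece (c := 0) (d := δ - a) (g := fun _ => u) (by linarith)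
    intervalIntegrable_const fun t ht => by simp only [splice]; rw [if_pos ht.2]
  obtain ⟨i2, e2⟩ := piece (by linarith) g2 fun t ht => by
    simp only [splice]; rw [if_neg (not_le.2 ht.1), if_pos ht.2]
  obtain ⟨i3, e3⟩ := piece (c := s - a) (d := s + b) (g := fun _ => v) (by linarith)
    intervalIntegrable_const fun t ht => by
    simp only [splice]
    rw [if_neg (by linarith [ht.1]), if_neg (not_le.2 ht.1), if_pos ht.2]
  obtain ⟨i4, e4⟩ := piece (by linarith) g4 fun t ht => by
    simp only [splice]
    rw [if_neg (by linarith [ht.1]), if_neg (by linarith [ht.1]), if_neg (not_le.2 ht.1),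
      if_pos ht.2]
  obtain ⟨i5, e5⟩ := piece (c := T - δ + b) (d := T) (g := fun _ => w) (by linarith)
    intervalIntegrable_const fun t ht => by
    simp only [splice]
    rw [if_neg (by linarith [ht.1]), if_neg (by linarith [ht.1]), if_neg (by linarith [ht.1]),
      if_neg (not_le.2 ht.1)]
  have j2 := i1.trans i2
  have j3 := j2.trans i3
  have j4 := j3.trans i4
  refine ⟨j4.trans i5, ?_⟩
  rw [← intervalIntegral.integral_add_adjacent_intervals j4 i5,
    ← intervalIntegral.integral_add_adjacent_intervals j3 i4,
    ← intervalIntegral.integral_add_adjacent_intervals j2 i3,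
    ← intervalIntegral.integral_add_adjacent_intervals i1 i2, e1, e2, e3, e4, e5,
    intervalIntegral.integral_comp_add_right, intervalIntegral.integral_comp_sub_right,
    ← intervalIntegral.integral_add_adjacent_intervals (b := s)
      (hf' (c := δ) (by linarith) hs (by linarith)) (hf' (by linarith) hsT (by linarith))]
  simp only [intervalIntegral.integral_const, smul_eq_mul, sub_add_cancel, add_sub_cancel_right]
  ring

end Splice

section Surgery

variable {D H β0 P V T : ℝ} {x p1 p2 : ℝ → ℝ}

/-- Shortening a trajectory by `a` at its start and by `b` at its end, hovering at `x s` for a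
duration `a + b` instead, and using constant rates near the two ends. -/
lemma exists_splice (hV : 0 ≤ V) (hx : FeasibleTraj V T x)
    (hp : FeasiblePower P T p1 p2) {r1 r2 : ℝ → ℝ}
    (hr1 : IntervalIntegrable r1 volume 0 T) (hr2 : IntervalIntegrable r2 volume 0 T)
    (hr : ∀ t ∈ Set.Icc 0 T,
      Supports P (h1 D H β0 (x t)) (h2 D H β0 (x t)) (p1 t) (p2 t) (r1 t) (r2 t))
    {s δ a b : ℝ} (ha : 0 ≤ a) (hb : 0 ≤ b) (haδ : a ≤ δ) (hbδ : b ≤ δ) (hs : δ ≤ s)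
    (hsT : s ≤ T - δ) {q1 q2 y1 y2 q1' q2' c1 c2 q1'' q2'' z1 z2 : ℝ}
    (hy : ∀ t ∈ Set.Icc 0 T, t ≤ δ →
      Supports P (h1 D H β0 (x t)) (h2 D H β0 (x t)) q1 q2 y1 y2)
    (hc : Supports P (h1 D H β0 (x s)) (h2 D H β0 (x s)) q1' q2' c1 c2)
    (hz : ∀ t ∈ Set.Icc 0 T, T - δ ≤ t →
      Supports P (h1 D H β0 (x t)) (h2 D H β0 (x t)) q1'' q2'' z1 z2) :
    ∃ x' p1' p2' r1' r2' : ℝ → ℝ, FeasibleTraj V T x' ∧ FeasiblePower P T p1' p2' ∧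
      IntervalIntegrable r1' volume 0 T ∧ IntervalIntegrable r2' volume 0 T ∧
      (∀ t ∈ Set.Icc 0 T,
        Supports P (h1 D H β0 (x' t)) (h2 D H β0 (x' t)) (p1' t) (p2' t) (r1' t) (r2' t)) ∧
      ∫ t in (0 : ℝ)..T, r1' t =
        (δ - a) * y1 + (∫ t in δ..(T - δ), r1 t) + (a + b) * c1 + (δ - b) * z1 ∧
      ∫ t in (0 : ℝ)..T, r2' t =
        (δ - a) * y2 + (∫ t in δ..(T - δ), r2 t) + (a + b) * c2 + (δ - b) * z2 := by
  obtain ⟨j1, e1⟩ := integral_splice (u := y1) (v := c1) (w := z1) ha hb haδ hbδ hs hsT hr1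
  obtain ⟨j2, e2⟩ := integral_splice (u := y2) (v := c2) (w := z2) ha hb haδ hbδ hs hsT hr2
  have hφ : ∀ t ∈ Set.Icc 0 T, min (t + a) (max s (t - b)) ∈ Set.Icc 0 T := fun t ht =>
    ⟨le_min (by linarith [ht.1]) (le_max_of_le_left (by linarith)),
      (min_le_right _ _).trans (max_le (by linarith) (by linarith [ht.2]))⟩
  have hsup : ∀ t ∈ Set.Icc 0 T,
      Supports P (h1 D H β0 (x (min (t + a) (max s (t - b)))))
        (h2 D H β0 (x (min (t + a) (max s (t - b)))))
        (splice T s δ a b q1 q1' q1'' p1 t) (splice T s δ a b q2 q2' q2'' p2 t)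
        (splice T s δ a b y1 c1 z1 r1 t) (splice T s δ a b y2 c2 z2 r2 t) := by
    intro t ht
    obtain ⟨ht0, htT⟩ := ht
    simp only [splice]
    split_ifs with k1 k2 k3 k4
    · rw [max_eq_left (by linarith), min_eq_left (by linarith)]
      exact hy _ ⟨by linarith, by linarith⟩ (by linarith)
    · rw [max_eq_left (by linarith), min_eq_left (by linarith)]
      exact hr _ ⟨by linarith, by linarith⟩
    · rw [max_eq_left (by linarith), min_eq_right (by linarith)]
      exact hc
    · rw [max_eq_right (by linarith), min_eq_right (by linarith)]
      exact hr _ ⟨by linarith, by linarith⟩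
    · rw [max_eq_right (by linarith), min_eq_right (by linarith)]
      exact hz _ ⟨by linarith, by linarith⟩ (by linarith)
  refine ⟨fun t => x (min (t + a) (max s (t - b))), splice T s δ a b q1 q1' q1'' p1,
    splice T s δ a b q2 q2' q2'' p2, splice T s δ a b y1 c1 z1 r1, splice T s δ a b y2 c2 z2 r2,
    fun t ht t' ht' => ?_, ⟨measurable_splice hp.1, measurable_splice hp.2.1, fun t ht => ?_⟩,
    j1, j2, hsup, e1, e2⟩
  · refine (hx _ (hφ t ht) _ (hφ t' ht')).trans (mul_le_mul_of_nonneg_left ?_ hV)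
    refine (abs_min_sub_min_le_max _ _ _ _).trans (max_le (by simp) ?_)
    refine (abs_max_sub_max_le_max _ _ _ _).trans (max_le (by simp) (by simp))
  · obtain ⟨a1, a2, a3, -⟩ := hsup t ht
    exact ⟨a1, a2, a3⟩

lemma eventually_forall_dist_le {y : ℝ} {Q : ℝ → Prop} (hV : 0 < V) (hx : FeasibleTraj V T x)
    (hy : y ∈ Set.Icc 0 T) (hQ : ∀ᶠ z in nhds (x y), Q z) :
    ∀ᶠ δ in nhdsWithin (0 : ℝ) (Set.Ioi 0), ∀ t ∈ Set.Icc 0 T, |t - y| ≤ δ → Q (x t) := by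
  obtain ⟨ε, hε, h⟩ := Metric.eventually_nhds_iff.1 hQ
  filter_upwards [Ioo_mem_nhdsGT (div_pos hε hV)] with δ hδ t ht htδ
  refine h ?_
  rw [Real.dist_eq]
  calc |x t - x y| ≤ V * |t - y| := hx t ht y hy
    _ ≤ V * δ := mul_le_mul_of_nonneg_left htδ hV.le
    _ < ε := by rw [mul_comm]; exact (lt_div_iff₀ hV).1 hδ.2

lemma Supports.mem_gainRegion {k1 k2 q1 q2 r1 r2 : ℝ} (h : Supports P k1 k2 q1 q2 r1 r2)
    (h1 : 0 ≤ r1) (h2 : 0 ≤ r2) : (r1, r2) ∈ gainRegion k1 k2 P :=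
  let ⟨a1, a2, a3, a4, a5, a6⟩ := h
  ⟨q1, q2, a1, a2, a3, h1, h2, a4, a5, a6⟩

lemma gainRegion_subset_of_le {k1 k2 l1 l2 η : ℝ} (hk1 : 0 ≤ k1) (hk2 : 0 ≤ k2)
    (hη : 0 ≤ η) (h1 : k1 ≤ (1 + η) * l1) (h2 : k2 ≤ (1 + η) * l2) :
    gainRegion k1 k2 P ⊆ gainRegion l1 l2 ((1 + η) * P) := by
  rintro r ⟨p1, p2, a1, a2, a3, a4, a5, a6, a7, a8⟩
  have e1 : p1 * k1 ≤ (1 + η) * p1 * l1 := by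
    have := mul_le_mul_of_nonneg_left h1 a1
    linarith
  have e2 : p2 * k2 ≤ (1 + η) * p2 * l2 := by
    have := mul_le_mul_of_nonneg_left h2 a2
    linarith
  have c1 := mul_nonneg a1 hk1
  have c2 := mul_nonneg a2 hk2
  refine ⟨(1 + η) * p1, (1 + η) * p2, by positivity, by positivity, ?_, a4, a5, a6.trans ?_,
    a7.trans ?_, a8.trans ?_⟩
  · rw [← mul_add]
    exact mul_le_mul_of_nonneg_left a3 (by linarith)
  all_goals exact Real.logb_le_logb_of_le (by norm_num) (by linarith) (by linarith)

/-- A limit of averages of rate pairs over shrinking time windows at `y` is achievable at the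
fixed location `x y`. -/
lemma mem_Cf_of_tendsto_average (hH : 0 < H) (hβ : 0 < β0) (hP : 0 < P) (hV : 0 < V)
    (hx : FeasibleTraj V T x) {r1 r2 : ℝ → ℝ}
    (hr1 : IntervalIntegrable r1 volume 0 T) (hr2 : IntervalIntegrable r2 volume 0 T)
    (hr : ∀ t ∈ Set.Icc 0 T, (r1 t, r2 t) ∈ Cf D H β0 P (x t)) {y : ℝ} (hy : y ∈ Set.Icc 0 T)
    {F : Filter ℝ} [F.NeBot] (hF : F ≤ nhdsWithin 0 (Set.Ioi 0)) {u v : ℝ → ℝ}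
    (huv : ∀ᶠ δ in F, 0 ≤ u δ ∧ u δ < v δ ∧ v δ ≤ T ∧ ∀ t ∈ Set.Icc (u δ) (v δ), |t - y| ≤ δ)
    {b : ℝ × ℝ} (hb : Filter.Tendsto (fun δ => ((∫ t in (u δ)..(v δ), r1 t) / (v δ - u δ),
      (∫ t in (u δ)..(v δ), r2 t) / (v δ - u δ))) F (nhds b)) :
    b ∈ Cf D H β0 P (x y) := by
  have k1 := h1_pos (D := D) hH hβ (x y)
  have k2 := h2_pos (D := D) hH hβ (x y)
  have key : ∀ η : ℝ, 0 < η →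
      b ∈ gainRegion (h1 D H β0 (x y)) (h2 D H β0 (x y)) ((1 + η) * P) := by
    intro η hη
    have hQ : ∀ᶠ z in nhds (x y), h1 D H β0 z < (1 + η) * h1 D H β0 (x y) ∧
        h2 D H β0 z < (1 + η) * h2 D H β0 (x y) :=
      ((continuous_h1 hH).continuousAt.eventually_lt_const (by nlinarith)).and
        ((continuous_h2 hH).continuousAt.eventually_lt_const (by nlinarith))
    refine (isClosed_gainRegion _ k1 k2).mem_of_tendsto hb ?_
    filter_upwards [huv, hF (eventually_forall_dist_le hV hx hy hQ)] with δ hδ hδQ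
    obtain ⟨d1, d2, d3, d4⟩ := hδ
    have hsub : Set.uIcc (u δ) (v δ) ⊆ Set.uIcc 0 T := by
      rw [Set.uIcc_of_le d2.le, Set.uIcc_of_le (by linarith)]
      exact Set.Icc_subset_Icc d1 d3
    refine average_mem_of_convex (convex_gainRegion _ k1 k2) (isClosed_gainRegion _ k1 k2) d2
      (hr1.mono_set hsub) (hr2.mono_set hsub) fun t ht => ?_
    have htT : t ∈ Set.Icc 0 T := ⟨d1.trans ht.1, ht.2.trans d3⟩
    have hq := hδQ t htT (d4 t ht)
    exact gainRegion_subset_of_le (h1_pos hH hβ _).le (h2_pos hH hβ _).le hη.le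
      hq.1.le hq.2.le (hr t htT)
  rw [Cf_eq_gainRegion, mem_gainRegion_iff k1 k2]
  have h1 := (mem_gainRegion_iff k1 k2).1 (key 1 one_pos)
  refine ⟨h1.1, h1.2.1, le_of_forall_pos_le_add fun ε hε => ?_⟩
  have h2 := ((mem_gainRegion_iff k1 k2).1 (key (ε / P) (div_pos hε hP))).2.2
  have : (1 + ε / P) * P = P + ε := by field_simp
  rwa [this] at h2

/-- Near a location, the powers of a supported rate pair still support any slightly smaller
rate pair. -/
lemma eventually_supports (hH : 0 < H) (hβ : 0 < β0) {y : ℝ} {b : ℝ × ℝ}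
    (hb : b ∈ Cf D H β0 P y) :
    ∃ q1 q2 : ℝ, ∀ ε : ℝ, 0 < ε → ∀ᶠ z in nhds y,
      Supports P (h1 D H β0 z) (h2 D H β0 z) q1 q2 (b.1 - ε) (b.2 - ε) := by
  obtain ⟨q1, q2, a1, a2, a3, -, -, a6, a7, a8⟩ := hb
  refine ⟨q1, q2, fun ε hε => ?_⟩
  have c1 : Continuous (h1 D H β0) := continuous_h1 hH
  have c2 : Continuous (h2 D H β0) := continuous_h2 hH
  have n1 := fun z => mul_nonneg a1 (h1_pos (D := D) hH hβ z).le
  have n2 := fun z => mul_nonneg a2 (h2_pos (D := D) hH hβ z).le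
  have cont : ∀ {g : ℝ → ℝ}, Continuous g → (∀ z, 0 ≤ g z) →
      Continuous fun z => Real.logb 2 (1 + g z) := fun hg h0 =>
    Continuous.div_const (Continuous.log (by fun_prop) fun z => by linarith [h0 z]) _
  have d1 := cont (c1.const_mul q1) n1
  have d2 := cont (c2.const_mul q2) n2
  have d3 : Continuous fun z => Real.logb 2 (1 + q1 * h1 D H β0 z + q2 * h2 D H β0 z) := by
    simp only [add_assoc]
    exact cont ((c1.const_mul q1).add (c2.const_mul q2)) fun z => add_nonneg (n1 z) (n2 z)
  filter_upwards [d1.continuousAt.eventually_const_lt (show b.1 - ε < _ by linarith),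
    d2.continuousAt.eventually_const_lt (show b.2 - ε < _ by linarith),
    d3.continuousAt.eventually_const_lt (show b.1 - ε + (b.2 - ε) < _ by linarith)]
    with z e1 e2 e3
  exact ⟨a1, a2, a3, e1.le, e2.le, e3.le⟩

end Surgery

/-- At an optimal trajectory, some achievable rate pairs `b`, `b'` at the two end locations are
such that no rate pair achievable at an intermediate location strictly dominates a mixture of `b`
and `b'`. -/
lemma exists_not_dominated {D H β0 P V T : ℝ} (hH : 0 < H) (hβ : 0 < β0) (hP : 0 < P)
    (hV : 0 < V) (hT : 0 < T) {x p1 p2 : ℝ → ℝ} (hx : FeasibleTraj V T x)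
    (hp : FeasiblePower P T p1 p2) {R1 R2 : ℝ} (hR : Achievable D H β0 T x p1 p2 R1 R2)
    (hmax : ∀ x' p1' p2' : ℝ → ℝ, FeasibleTraj V T x' → FeasiblePower P T p1' p2' →
      ∀ S1 S2 : ℝ, Achievable D H β0 T x' p1' p2' S1 S2 → ¬ (R1 < S1 ∧ R2 < S2))
    {s : ℝ} (hs0 : 0 < s) (hsT : s < T) :
    ∃ b ∈ Cf D H β0 P (x 0), ∃ b' ∈ Cf D H β0 P (x T),
      ∀ θ : ℝ, 0 ≤ θ → θ ≤ 1 → ∀ c ∈ Cf D H β0 P (x s),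
        ¬ (θ * b.1 + (1 - θ) * b'.1 < c.1 ∧ θ * b.2 + (1 - θ) * b'.2 < c.2) := by
  obtain ⟨r1, r2, i1, i2, hr, hI1, hI2⟩ := hR.exists_supports hH hβ hT hx hp
  have hrC : ∀ t ∈ Set.Icc 0 T, (r1 t, r2 t) ∈ Cf D H β0 P (x t) := fun t ht =>
    (hr t ht).2.2.mem_gainRegion (hr t ht).1 (hr t ht).2.1
  set M := Real.logb 2 (1 + P * (β0 / H ^ 2)) with hM
  set K : Set (ℝ × ℝ) := Set.Icc (0, 0) (M, M) with hK
  have hrK : ∀ t ∈ Set.Icc 0 T, (r1 t, r2 t) ∈ K := by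
    intro t ht
    obtain ⟨n1, n2, -, -, -, l1, l2, -⟩ := hr t ht
    have b1 := hp.mul_h1_mem (D := D) (x := x) hH hβ ht
    have b2 := hp.mul_h2_mem (D := D) (x := x) hH hβ ht
    exact ⟨⟨n1, n2⟩,
      l1.trans (Real.logb_le_logb_of_le (by norm_num) (by linarith) (by linarith)),
      l2.trans (Real.logb_le_logb_of_le (by norm_num) (by linarith) (by linarith))⟩
  have hsub : ∀ {u v : ℝ}, 0 ≤ u → u ≤ v → v ≤ T → Set.uIcc u v ⊆ Set.uIcc 0 T := by
    intro u v h1 h2 h3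
    rw [Set.uIcc_of_le h2, Set.uIcc_of_le (h1.trans (h2.trans h3))]
    exact Set.Icc_subset_Icc h1 h3
  have havg : ∀ {u v : ℝ}, 0 ≤ u → u < v → v ≤ T →
      ((∫ t in u..v, r1 t) / (v - u), (∫ t in u..v, r2 t) / (v - u)) ∈ K := by
    intro u v h1 h2 h3
    exact average_mem_of_convex (convex_Icc _ _) isClosed_Icc h2
      (i1.mono_set (hsub h1 h2.le h3)) (i2.mono_set (hsub h1 h2.le h3))
      fun t ht => hrK t ⟨h1.trans ht.1, ht.2.trans h3⟩
  let F : Ultrafilter ℝ := Ultrafilter.of (nhdsWithin 0 (Set.Ioi 0))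
  have hF : (F : Filter ℝ) ≤ nhdsWithin 0 (Set.Ioi 0) := Ultrafilter.of_le _
  have lim : ∀ u v : ℝ → ℝ, (∀ δ ∈ Set.Ioo 0 T, 0 ≤ u δ ∧ u δ < v δ ∧ v δ ≤ T) →
      ∃ b, Filter.Tendsto (fun δ => ((∫ t in (u δ)..(v δ), r1 t) / (v δ - u δ),
        (∫ t in (u δ)..(v δ), r2 t) / (v δ - u δ))) F (nhds b) := by
    intro u v huv
    obtain ⟨b, -, hb⟩ := (isCompact_Icc (a := ((0, 0) : ℝ × ℝ)) (b := (M, M))).ultrafilter_le_nhds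
      (F.map fun δ => ((∫ t in (u δ)..(v δ), r1 t) / (v δ - u δ),
        (∫ t in (u δ)..(v δ), r2 t) / (v δ - u δ))) (by
        rw [Filter.le_principal_iff, Ultrafilter.mem_coe, Ultrafilter.mem_map]
        filter_upwards [hF (Ioo_mem_nhdsGT hT)] with δ hδ
        obtain ⟨h1, h2, h3⟩ := huv δ hδ
        exact havg h1 h2 h3)
    exact ⟨b, hb⟩
  obtain ⟨b, hb⟩ := lim (fun _ => 0) (fun δ => δ) fun δ hδ => ⟨le_rfl, hδ.1, hδ.2.le⟩
  obtain ⟨b', hb'⟩ := lim (fun δ => T - δ) (fun _ => T)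
    fun δ hδ => ⟨by linarith [hδ.2], by linarith [hδ.1], le_rfl⟩
  have h0mem : (0 : ℝ) ∈ Set.Icc 0 T := ⟨le_rfl, hT.le⟩
  have hTmem : T ∈ Set.Icc 0 T := ⟨hT.le, le_rfl⟩
  have hbC : b ∈ Cf D H β0 P (x 0) := by
    refine mem_Cf_of_tendsto_average hH hβ hP hV hx i1 i2 hrC h0mem hF ?_ hb
    filter_upwards [hF (Ioo_mem_nhdsGT hT)] with δ hδ
    exact ⟨le_rfl, hδ.1, hδ.2.le, fun t ht => abs_le.2 ⟨by linarith [ht.1, hδ.1],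
      by linarith [ht.2]⟩⟩
  have hbC' : b' ∈ Cf D H β0 P (x T) := by
    refine mem_Cf_of_tendsto_average hH hβ hP hV hx i1 i2 hrC hTmem hF ?_ hb'
    filter_upwards [hF (Ioo_mem_nhdsGT hT)] with δ hδ
    exact ⟨by linarith [hδ.2], by linarith [hδ.1], le_rfl,
      fun t ht => abs_le.2 ⟨by linarith [ht.1], by linarith [ht.2, hδ.1]⟩⟩
  refine ⟨b, hbC, b', hbC', fun θ hθ0 hθ1 c hc ⟨hc1, hc2⟩ => ?_⟩
  obtain ⟨q1, q2, hq⟩ := eventually_supports hH hβ hbC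
  obtain ⟨q1', q2', hq'⟩ := eventually_supports hH hβ hbC'
  obtain ⟨qc1, qc2, hqc⟩ := hc
  obtain ⟨ε, hε, g1, g2⟩ : ∃ ε : ℝ, 0 < ε ∧ θ * b.1 + (1 - θ) * b'.1 + 3 * ε ≤ c.1 ∧
      θ * b.2 + (1 - θ) * b'.2 + 3 * ε ≤ c.2 := by
    refine ⟨min (c.1 - (θ * b.1 + (1 - θ) * b'.1)) (c.2 - (θ * b.2 + (1 - θ) * b'.2)) / 3,
      div_pos (lt_min (by linarith) (by linarith)) (by norm_num), ?_, ?_⟩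
    · linarith [min_le_left (c.1 - (θ * b.1 + (1 - θ) * b'.1))
        (c.2 - (θ * b.2 + (1 - θ) * b'.2))]
    · linarith [min_le_right (c.1 - (θ * b.1 + (1 - θ) * b'.1))
        (c.2 - (θ * b.2 + (1 - θ) * b'.2))]
  have near : ∀ {z : ℝ × ℝ} {f : ℝ → ℝ × ℝ}, Filter.Tendsto f F (nhds z) →
      ∀ᶠ δ in (F : Filter ℝ), (f δ).1 < z.1 + ε ∧ (f δ).2 < z.2 + ε := fun h =>
    ((continuous_fst.tendsto _).comp h |>.eventually_lt_const (by simpa using hε)).and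
      ((continuous_snd.tendsto _).comp h |>.eventually_lt_const (by simpa using hε))
  have ev0 : ∀ᶠ δ in (F : Filter ℝ), δ ∈ Set.Ioo 0 (min s (T - s)) :=
    hF (Ioo_mem_nhdsGT (lt_min hs0 (sub_pos.2 hsT)))
  have ev1 : ∀ᶠ δ in (F : Filter ℝ), ∀ t ∈ Set.Icc 0 T, |t - 0| ≤ δ →
      Supports P (h1 D H β0 (x t)) (h2 D H β0 (x t)) q1 q2 (b.1 - ε) (b.2 - ε) :=
    hF (eventually_forall_dist_le hV hx h0mem (hq ε hε))
  have ev2 : ∀ᶠ δ in (F : Filter ℝ), ∀ t ∈ Set.Icc 0 T, |t - T| ≤ δ →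
      Supports P (h1 D H β0 (x t)) (h2 D H β0 (x t)) q1' q2' (b'.1 - ε) (b'.2 - ε) :=
    hF (eventually_forall_dist_le hV hx hTmem (hq' ε hε))
  obtain ⟨δ, hδ, n, n', hsup, hsup'⟩ :=
    (ev0.and ((near hb).and ((near hb').and (ev1.and ev2)))).exists
  obtain ⟨hδ0, hδm⟩ := hδ
  have hδs := hδm.trans_le (min_le_left _ _)
  have hδT := hδm.trans_le (min_le_right _ _)
  simp only [sub_zero, sub_sub_cancel, div_lt_iff₀ hδ0] at n n'
  have hθδ : θ * δ ≤ δ := mul_le_of_le_one_left hδ0.le hθ1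
  have hθδ' : (1 - θ) * δ ≤ δ := mul_le_of_le_one_left hδ0.le (by linarith)
  obtain ⟨x', p1', p2', r1', r2', hx', hp', j1, j2, hr', e1, e2⟩ := exists_splice hV.le hx hp
    i1 i2 (fun t ht => (hr t ht).2.2) (s := s) (δ := δ) (a := θ * δ) (b := (1 - θ) * δ)
    (by positivity) (mul_nonneg (by linarith) hδ0.le) hθδ hθδ' hδs.le (by linarith)
    (fun t ht h => hsup t ht (abs_le.2 ⟨by linarith [ht.1], by linarith⟩))
    (c1 := c.1) (c2 := c.2) (q1' := qc1) (q2' := qc2)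
    ⟨hqc.1, hqc.2.1, hqc.2.2.1, hqc.2.2.2.2.2⟩
    (fun t ht h => hsup' t ht (abs_le.2 ⟨by linarith, by linarith [ht.2]⟩))
  have split : ∀ {r : ℝ → ℝ}, IntervalIntegrable r volume 0 T → ∫ t in (0 : ℝ)..T, r t =
      (∫ t in (0 : ℝ)..δ, r t) + (∫ t in δ..(T - δ), r t) + ∫ t in (T - δ)..T, r t := by
    intro r hr
    have k1 := hr.mono_set (hsub le_rfl hδ0.le (by linarith))
    have k2 := hr.mono_set (hsub hδ0.le (by linarith : δ ≤ T - δ) (by linarith))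
    have k3 := hr.mono_set (hsub (by linarith) (by linarith : T - δ ≤ T) le_rfl)
    rw [intervalIntegral.integral_add_adjacent_intervals k1 k2,
      intervalIntegral.integral_add_adjacent_intervals (k1.trans k2) k3]
  rw [split i1] at hI1
  rw [split i2] at hI2
  have G1 := mul_le_mul_of_nonneg_right g1 hδ0.le
  have G2 := mul_le_mul_of_nonneg_right g2 hδ0.le
  have hεδ := mul_pos hε hδ0
  have f1 : R1 * T < ∫ t in (0 : ℝ)..T, r1' t := by
    rw [e1]
    linarith [n.1, n'.1]
  have f2 : R2 * T < ∫ t in (0 : ℝ)..T, r2' t := by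
    rw [e2]
    linarith [n.2, n'.2]
  have f1' := (lt_div_iff₀ hT).2 f1
  have f2' := (lt_div_iff₀ hT).2 f2
  exact hmax x' p1' p2' hx' hp' _ _ (achievable_of_supports hH hβ hT hx' hp' j1 j2 hr'
    (hR.1.trans f1'.le) (hR.2.1.trans f2'.le) (div_mul_cancel₀ _ hT.ne').le
    (div_mul_cancel₀ _ hT.ne').le) ⟨f1', f2'⟩

lemma bddAbove_rateProfile {D H β0 P V T α1 α2 : ℝ} (hH : 0 < H) (hβ : 0 < β0) (hT : 0 < T)
    (hα1 : 0 < α1) :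
    BddAbove {r : ℝ | ∃ x p1 p2, FeasibleTraj V T x ∧ FeasiblePower P T p1 p2 ∧
      ∃ r1 r2, Achievable D H β0 T x p1 p2 r1 r2 ∧ α1 * r ≤ r1 ∧ α2 * r ≤ r2} := by
  refine ⟨Real.logb 2 (1 + P * (β0 / H ^ 2)) / α1, ?_⟩
  rintro r ⟨x, p1, p2, hx, hp, r1, r2, ⟨-, -, h, -⟩, hr, -⟩
  rw [le_div_iff₀ hα1, mul_comm]
  refine hr.trans (h.trans ?_)
  rw [one_div_mul_eq_div, div_le_iff₀ hT]
  refine (intervalIntegral.integral_mono_on hT.le (intervalIntegrable_rates hH hβ hT.le hx hp).1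
    (intervalIntegrable_const (c := Real.logb 2 (1 + P * (β0 / H ^ 2)))) fun t ht => ?_).trans
    (by simp [mul_comm])
  have b1 := hp.mul_h1_mem (D := D) (x := x) hH hβ ht
  exact Real.logb_le_logb_of_le (by norm_num) (by linarith) (by linarith)

/-- (Proposition 3.) Fix `V > 0` and a rate profile
`(α1, α2)` with `α1, α2 > 0`, `α1 + α2 = 1`, and let `r*` be the optimal value of
the rate-profile problem. If a feasible triple `(x*, p1*, p2*)`, with `x*`
nondecreasing on `[0, T]`, valued in `[-D/2, D/2]`, attains the optimum, i.e.
`(α1 r*, α2 r*)` is achievable for it, then for every `x_A` between the initial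
location `x*(0)` and the final location `x*(T)`,
`C_f(x_A) ⊆ Conv(C_f(x*(0)) ∪ C_f(x*(T)))`. -/
theorem hovering_endpoints_dominate (D H β0 P V T α1 α2 : ℝ)
    (hD : 0 < D) (hH : 0 < H) (hβ : 0 < β0) (hP : 0 < P) (hV : 0 < V) (hT : 0 < T)
    (hα1 : 0 < α1) (hα2 : 0 < α2) (hα : α1 + α2 = 1)
    (xstar p1star p2star : ℝ → ℝ)
    (hx : FeasibleTraj V T xstar) (hmono : MonotoneOn xstar (Set.Icc (0 : ℝ) T))
    (hval : ∀ t ∈ Set.Icc (0 : ℝ) T, xstar t ∈ Set.Icc (-(D / 2)) (D / 2))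
    (hp : FeasiblePower P T p1star p2star)
    (hopt : Achievable D H β0 T xstar p1star p2star
      (α1 * sSup {r : ℝ | ∃ x p1 p2, FeasibleTraj V T x ∧ FeasiblePower P T p1 p2 ∧
        ∃ r1 r2, Achievable D H β0 T x p1 p2 r1 r2 ∧ α1 * r ≤ r1 ∧ α2 * r ≤ r2})
      (α2 * sSup {r : ℝ | ∃ x p1 p2, FeasibleTraj V T x ∧ FeasiblePower P T p1 p2 ∧
        ∃ r1 r2, Achievable D H β0 T x p1 p2 r1 r2 ∧ α1 * r ≤ r1 ∧ α2 * r ≤ r2})) :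
    ∀ xA : ℝ, xstar 0 ≤ xA → xA ≤ xstar T →
      Cf D H β0 P xA ⊆
        convexHull ℝ (Cf D H β0 P (xstar 0) ∪ Cf D H β0 P (xstar T)) := by
  set S := {r : ℝ | ∃ x p1 p2, FeasibleTraj V T x ∧ FeasiblePower P T p1 p2 ∧
    ∃ r1 r2, Achievable D H β0 T x p1 p2 r1 r2 ∧ α1 * r ≤ r1 ∧ α2 * r ≤ r2} with hS
  have hbdd : BddAbove S := bddAbove_rateProfile hH hβ hT hα1
  intro xA hIA hAF
  have h0mem : (0 : ℝ) ∈ Set.Icc 0 T := ⟨le_rfl, hT.le⟩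
  have hTmem : T ∈ Set.Icc 0 T := ⟨hT.le, le_rfl⟩
  rcases hIA.eq_or_lt with rfl | hIA
  · exact Set.subset_union_left.trans (subset_convexHull ℝ _)
  rcases hAF.eq_or_lt with rfl | hAF
  · exact Set.subset_union_right.trans (subset_convexHull ℝ _)
  obtain ⟨s, hs, rfl⟩ := intermediate_value_Icc hT.le hx.continuousOn ⟨hIA.le, hAF.le⟩
  have hs0 : 0 < s := hs.1.lt_of_ne fun h => by simp [← h] at hIA
  have hsT : s < T := hs.2.lt_of_ne fun h => by simp [h] at hAF
  have hmax : ∀ x' p1' p2' : ℝ → ℝ, FeasibleTraj V T x' → FeasiblePower P T p1' p2' →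
      ∀ S1 S2 : ℝ, Achievable D H β0 T x' p1' p2' S1 S2 →
        ¬ (α1 * sSup S < S1 ∧ α2 * sSup S < S2) := by
    intro x' p1' p2' hx' hp' S1 S2 hach ⟨l1, l2⟩
    have e1 : sSup S < S1 / α1 := (lt_div_iff₀' hα1).2 l1
    have e2 : sSup S < S2 / α2 := (lt_div_iff₀' hα2).2 l2
    have hmem : min (S1 / α1) (S2 / α2) ∈ S :=
      ⟨x', p1', p2', hx', hp', S1, S2, hach, (le_div_iff₀' hα1).1 (min_le_left _ _),
        (le_div_iff₀' hα2).1 (min_le_right _ _)⟩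
    exact (le_csSup hbdd hmem).not_gt (lt_min e1 e2)
  obtain ⟨b, hb, b', hb', hdom⟩ :=
    exists_not_dominated hH hβ hP hV hT hx hp hopt hmax hs0 hsT
  obtain ⟨l, m, hl, hm, hlm, hle, hle'⟩ := exists_weights_of_not_dominated
    (convex_gainRegion P (h1_pos hH hβ _) (h2_pos hH hβ _))
    ⟨0, 0, 0, le_rfl, le_rfl, by simpa using hP.le, by simp⟩ hdom
  exact gainRegion_subset_convexHull hP (h2_pos hH hβ _) (h1_pos hH hβ _)
    (h1_lt_h1 hH hβ (hval 0 h0mem).1 hIA) (h2_lt_h2 hH hβ (hval s hs).2 hIA)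
    (h1_lt_h1 hH hβ (hval s hs).1 hAF) (h2_lt_h2 hH hβ (hval T hTmem).2 hAF)
    hl hm hlm hb hb' hle hle'
end

section
/- Let -D/2 ≤ x_C < x_B ≤ D/2 and, for m ∈ {B, C}, define the Pareto boundary function R2^m(s) = sup{ r2 : (s, r2) ∈ C_f(x_m) } for 0 ≤ s ≤ log2(1 + P̄ h1(x_m)). Then there exists a unique r̄1 with 0 < r̄1 < log2(1 + P̄ h1(x_B)) such that R2^B(r̄1) = R2^C(r̄1); moreover the common value r̄2 satisfies 0 < r̄2 < log2(1 + P̄ h2(x_C)), and R2^B(s) > R2^C(s) for all 0 ≤ s < r̄1 while R2^B(s) < R2^C(s) for all r̄1 < s ≤ log2(1 + P̄ h1(x_B)). -/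
/-- The Pareto boundary function of `C_f(x)`: the largest `r2` such that
`(s, r2) ∈ C_f(x)`. -/
noncomputable def R2 (D H β0 P : ℝ) (x s : ℝ) : ℝ :=
  sSup {r2 : ℝ | (s, r2) ∈ Cf D H β0 P x}

/-- A real quadratic that is positive at `0` and negative at `M > 0` changes sign exactly once on
`[0, M]`. -/
theorem quadratic_sign_change {α β γ M : ℝ} (hM : 0 < M) (h0 : 0 < α)
    (hneg : α + β * M + γ * M ^ 2 < 0) :
    ∃ u₀, 0 < u₀ ∧ u₀ < M ∧ α + β * u₀ + γ * u₀ ^ 2 = 0 ∧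
      (∀ u, 0 ≤ u → u < u₀ → 0 < α + β * u + γ * u ^ 2) ∧
      (∀ u, u₀ < u → u ≤ M → α + β * u + γ * u ^ 2 < 0) := by
  have hcont : ContinuousOn (fun u : ℝ => α + β * u + γ * u ^ 2) (Set.Icc 0 M) := by fun_prop
  obtain ⟨u₀, ⟨hu0, huM⟩, hroot⟩ := intermediate_value_Ioo' hM.le hcont
    (show (0 : ℝ) ∈ Set.Ioo _ _ from ⟨hneg, by simpa using h0⟩)
  replace hroot : α + β * u₀ + γ * u₀ ^ 2 = 0 := hroot
  have hfactor : ∀ u, α + β * u + γ * u ^ 2 = (u - u₀) * (β + γ * (u + u₀)) := fun u => by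
    linear_combination hroot
  have hslope0 : β + γ * u₀ < 0 := by
    have := hfactor 0
    by_contra! h
    nlinarith [mul_nonneg hu0.le h]
  have hslopeM : β + γ * (M + u₀) < 0 := by
    have := hfactor M
    by_contra! h
    nlinarith [mul_nonneg (sub_pos.2 huM).le h]
  have hslope : ∀ u, 0 ≤ u → u ≤ M → β + γ * (u + u₀) < 0 := fun u h h' => by
    rcases le_total 0 γ with hγ | hγ
    · nlinarith [mul_le_mul_of_nonneg_left h' hγ]
    · nlinarith [mul_nonpos_of_nonpos_of_nonneg hγ h]
  refine ⟨u₀, hu0, huM, hroot, fun u h h' => ?_, fun u h h' => ?_⟩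
  · rw [hfactor]
    exact mul_pos_of_neg_of_neg (by linarith) (hslope u h (by linarith))
  · rw [hfactor]
    exact mul_neg_of_pos_of_neg (by linarith) (hslope u (by linarith) h')

/-- The largest SNR of user 2 when user 1 has SNR `u`, where `a` and `b` are the inverse channel
gains of the two users. -/
noncomputable def paretoSNR (P a b u : ℝ) : ℝ := (P - a * u) / (b + min a b * u)

theorem R2_eq_logb_paretoSNR {D H β0 P x s a b : ℝ} (ha : 0 < a) (hb : 0 < b)
    (hh1 : h1 D H β0 x = a⁻¹) (hh2 : h2 D H β0 x = b⁻¹) (hs : 0 ≤ s)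
    (hsP : a * ((2 : ℝ) ^ s - 1) ≤ P) :
    R2 D H β0 P x s = Real.logb 2 (1 + paretoSNR P a b ((2 : ℝ) ^ s - 1)) := by
  have hu : 0 ≤ (2 : ℝ) ^ s - 1 := by
    linarith [Real.one_le_rpow one_le_two hs]
  obtain ⟨u, hus⟩ : ∃ u, u = (2 : ℝ) ^ s - 1 := ⟨_, rfl⟩
  rw [← hus] at hu hsP ⊢
  have hs_eq : s = Real.logb 2 (1 + u) := by
    rw [hus, add_sub_cancel, Real.logb_rpow (by norm_num) (by norm_num)]
  have hm : 0 < min a b := lt_min ha hb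
  have hden : 0 < b + min a b * u := by positivity
  obtain ⟨v, hv⟩ : ∃ v, v = paretoSNR P a b u := ⟨_, rfl⟩
  have hveq : a * u + b * v + min a b * u * v = P := by
    rw [hv, paretoSNR]
    field_simp
    ring
  have hv0 : 0 ≤ v := by
    rw [hv]
    exact div_nonneg (by linarith) hden.le
  rw [← hv]
  refine IsGreatest.csSup_eq ⟨?_, ?_⟩
  · have hsum : s + Real.logb 2 (1 + v) = Real.logb 2 ((1 + u) * (1 + v)) := by
      rw [hs_eq, Real.logb_mul (by positivity) (by positivity)]
    have hr0 : 0 ≤ Real.logb 2 (1 + v) := Real.logb_nonneg one_lt_two (by linarith)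
    have huv : 0 ≤ u * v := mul_nonneg hu hv0
    suffices ∃ q₁ q₂ : ℝ, u ≤ q₁ ∧ v ≤ q₂ ∧ u + v + u * v ≤ q₁ + q₂ ∧ q₁ * a + q₂ * b ≤ P by
      obtain ⟨q₁, q₂, hq₁, hq₂, hq, hqP⟩ := this
      refine ⟨q₁ * a, q₂ * b, mul_nonneg (hu.trans hq₁) ha.le, mul_nonneg (hv0.trans hq₂) hb.le,
        hqP, hs, hr0, ?_, ?_, ?_⟩ <;>
        simp only [hh1, hh2, mul_inv_cancel_right₀ ha.ne', mul_inv_cancel_right₀ hb.ne', hsum]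
      · rw [hs_eq]
        exact Real.logb_le_logb_of_le one_lt_two (by linarith) (by linarith)
      · exact Real.logb_le_logb_of_le one_lt_two (by linarith) (by linarith)
      · exact Real.logb_le_logb_of_le one_lt_two (by positivity) (by linarith)
    rcases le_total a b with hab | hab
    · rw [min_eq_left hab] at hveq
      exact ⟨u + u * v, v, by linarith, le_rfl, by linarith, by linarith⟩
    · rw [min_eq_right hab] at hveq
      exact ⟨u, v + u * v, le_rfl, by linarith, by linarith, by linarith⟩
  · rintro r ⟨p₁, p₂, hp₁, hp₂, hpP, -, hr, hr₁, hr₂, hr₁₂⟩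
    simp only [hh1, hh2] at hr hr₁ hr₂ hr₁₂
    obtain ⟨q₁, rfl⟩ : ∃ q, p₁ = q * a := ⟨p₁ / a, by field_simp⟩
    obtain ⟨q₂, rfl⟩ : ∃ q, p₂ = q * b := ⟨p₂ / b, by field_simp⟩
    have hq₁ : 0 ≤ q₁ := nonneg_of_mul_nonneg_left hp₁ ha
    have hq₂ : 0 ≤ q₂ := nonneg_of_mul_nonneg_left hp₂ hb
    simp only [mul_inv_cancel_right₀ ha.ne', mul_inv_cancel_right₀ hb.ne'] at hr₁ hr₂ hr₁₂
    rw [Real.le_logb_iff_rpow_le one_lt_two (by positivity)] at hr₁ hr₂ hr₁₂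
    rw [Real.rpow_add two_pos] at hr₁₂
    rw [Real.le_logb_iff_rpow_le one_lt_two (by positivity)]
    have hw : 1 ≤ (2 : ℝ) ^ r := Real.one_le_rpow one_le_two hr
    obtain ⟨w, hwr⟩ : ∃ w, (2 : ℝ) ^ r = 1 + w := ⟨(2 : ℝ) ^ r - 1, by ring⟩
    have hsu : (2 : ℝ) ^ s = 1 + u := by linarith
    rw [hwr] at hr₂ hr₁₂ hw ⊢
    rw [hsu] at hr₁ hr₁₂
    have e₁ := mul_le_mul_of_nonneg_right (min_le_left a b) (show 0 ≤ q₁ - u by linarith)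
    have e₂ := mul_le_mul_of_nonneg_right (min_le_right a b) (show 0 ≤ q₂ - w by linarith)
    have e₃ := mul_le_mul_of_nonneg_left
      (show u * w ≤ (q₁ - u) + (q₂ - w) by linarith) hm.le
    have hwv : (b + min a b * u) * w ≤ (b + min a b * u) * v := by linarith
    linarith [le_of_mul_le_mul_left hwv hden]

theorem paretoSNR_pos {P a b u : ℝ} (ha : 0 < a) (hb : 0 < b) (hu : 0 ≤ u) (huP : a * u < P) :
    0 < paretoSNR P a b u := by
  have := lt_min ha hb
  exact div_pos (by linarith) (by positivity)

theorem paretoSNR_nonneg {P a b u : ℝ} (ha : 0 < a) (hb : 0 < b) (hu : 0 ≤ u) (huP : a * u ≤ P) :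
    0 ≤ paretoSNR P a b u := by
  have := lt_min ha hb
  exact div_nonneg (by linarith) (by positivity)

theorem paretoSNR_lt {P a b u : ℝ} (ha : 0 < a) (hb : 0 < b) (hP : 0 < P) (hu : 0 < u) :
    paretoSNR P a b u < P * b⁻¹ := by
  have := lt_min ha hb
  rw [← div_eq_mul_inv]
  exact div_lt_div₀ (by nlinarith [mul_pos ha hu]) (le_add_of_nonneg_right (by positivity)) hP.le hb

/-- Moving towards user 1 (from inverse gains `a, b` to `a', b'`) raises and lowers the optimal
SNR of user 2 on the two sides of a single crossing point. -/
theorem paretoSNR_single_crossing {P a b a' b' : ℝ} (hP : 0 < P) (ha' : 0 < a') (hb : 0 < b)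
    (haa' : a' < a) (hbb' : b < b') :
    ∃ u₀, 0 < u₀ ∧ u₀ < P / a ∧ paretoSNR P a b u₀ = paretoSNR P a' b' u₀ ∧
      (∀ u, 0 ≤ u → u < u₀ → paretoSNR P a' b' u < paretoSNR P a b u) ∧
      (∀ u, u₀ < u → u ≤ P / a → paretoSNR P a b u < paretoSNR P a' b' u) := by
  have ha : 0 < a := ha'.trans haa'
  have hb' : 0 < b' := hb.trans hbb'
  have hm := lt_min ha hb
  have hm' := lt_min ha' hb'
  unfold paretoSNR
  obtain ⟨m, hm_eq⟩ : ∃ m, m = min a b := ⟨_, rfl⟩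
  obtain ⟨m', hm'_eq⟩ : ∃ m', m' = min a' b' := ⟨_, rfl⟩
  rw [← hm_eq] at hm ⊢
  rw [← hm'_eq] at hm' ⊢
  have hM : 0 < P / a := div_pos hP ha
  have hexp : ∀ u, P * (b' - b) + (P * m' - a * b' - P * m + a' * b) * u + (a' * m - a * m') * u ^ 2
      = (P - a * u) * (b' + m' * u) - (P - a' * u) * (b + m * u) := fun u => by ring
  obtain ⟨u₀, h0, hlt, hroot, hleft, hright⟩ := quadratic_sign_change
    (β := P * m' - a * b' - P * m + a' * b) (γ := a' * m - a * m') hM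
    (mul_pos hP (sub_pos.2 hbb')) (by
      have hend : a * (P / a) = P := mul_div_cancel₀ P ha.ne'
      have hlt : a' * (P / a) < P := by
        calc a' * (P / a) < a * (P / a) := mul_lt_mul_of_pos_right haa' hM
          _ = P := hend
      have hprod : 0 < (P - a' * (P / a)) * (b + m * (P / a)) :=
        mul_pos (by linarith) (by positivity)
      rw [hexp, hend]
      linarith)
  refine ⟨u₀, h0, hlt, ?_, fun u hu hu' => ?_, fun u hu hu' => ?_⟩
  · rw [hexp] at hroot
    rw [div_eq_div_iff (by positivity) (by positivity)]
    linarith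
  · have := hleft u hu hu'
    rw [hexp] at this
    rw [div_lt_div_iff₀ (by positivity) (by positivity)]
    linarith
  · have := hright u hu hu'
    have hu0 : 0 < u := h0.trans hu
    rw [hexp] at this
    rw [div_lt_div_iff₀ (by positivity) (by positivity)]
    linarith

/-- (Lemma 6.) For hovering locations `-D/2 ≤ xC < xB ≤ D/2`,
the Pareto boundary functions of `C_f(xB)` and `C_f(xC)` have a unique
intersection point `(r̄1, r̄2)` with `0 < r̄1 < log2(1 + P̄ h1(xB))` and
`0 < r̄2 < log2(1 + P̄ h2(xC))`; to the left of `r̄1` the boundary of `C_f(xB)`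
is strictly higher, and to the right it is strictly lower. -/
theorem pareto_boundaries_unique_intersection (D H β0 P xB xC : ℝ)
    (hD : 0 < D) (hH : 0 < H) (hβ : 0 < β0) (hP : 0 < P)
    (hC : -(D / 2) ≤ xC) (hCB : xC < xB) (hB : xB ≤ D / 2) :
    ∃ rb1 : ℝ,
      0 < rb1 ∧ rb1 < Real.logb 2 (1 + P * h1 D H β0 xB) ∧
      R2 D H β0 P xB rb1 = R2 D H β0 P xC rb1 ∧
      (∀ s : ℝ, 0 < s → s < Real.logb 2 (1 + P * h1 D H β0 xB) →
        R2 D H β0 P xB s = R2 D H β0 P xC s → s = rb1) ∧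
      0 < R2 D H β0 P xB rb1 ∧
      R2 D H β0 P xB rb1 < Real.logb 2 (1 + P * h2 D H β0 xC) ∧
      (∀ s : ℝ, 0 ≤ s → s < rb1 → R2 D H β0 P xC s < R2 D H β0 P xB s) ∧
      (∀ s : ℝ, rb1 < s → s ≤ Real.logb 2 (1 + P * h1 D H β0 xB) →
        R2 D H β0 P xB s < R2 D H β0 P xC s) := by
  obtain ⟨a, ha_def⟩ : ∃ a, a = ((xB + D / 2) ^ 2 + H ^ 2) / β0 := ⟨_, rfl⟩
  obtain ⟨b, hb_def⟩ : ∃ b, b = ((xB - D / 2) ^ 2 + H ^ 2) / β0 := ⟨_, rfl⟩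
  obtain ⟨a', ha'_def⟩ : ∃ a, a = ((xC + D / 2) ^ 2 + H ^ 2) / β0 := ⟨_, rfl⟩
  obtain ⟨b', hb'_def⟩ : ∃ b, b = ((xC - D / 2) ^ 2 + H ^ 2) / β0 := ⟨_, rfl⟩
  have ha : 0 < a := by rw [ha_def]; positivity
  have hb : 0 < b := by rw [hb_def]; positivity
  have ha' : 0 < a' := by rw [ha'_def]; positivity
  have hb' : 0 < b' := by rw [hb'_def]; positivity
  have h1B : h1 D H β0 xB = a⁻¹ := by rw [ha_def, inv_div, h1]
  have h2B : h2 D H β0 xB = b⁻¹ := by rw [hb_def, inv_div, h2]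
  have h1C : h1 D H β0 xC = a'⁻¹ := by rw [ha'_def, inv_div, h1]
  have h2C : h2 D H β0 xC = b'⁻¹ := by rw [hb'_def, inv_div, h2]
  have haa' : a' < a := by
    rw [ha_def, ha'_def]
    exact div_lt_div_of_pos_right (by nlinarith) hβ
  have hbb' : b < b' := by
    rw [hb_def, hb'_def]
    exact div_lt_div_of_pos_right (by nlinarith) hβ
  obtain ⟨u₀, hu0, hlt, heq, hleft, hright⟩ := paretoSNR_single_crossing hP ha' hb haa' hbb'
  have hs₀ : (2 : ℝ) ^ Real.logb 2 (1 + u₀) = 1 + u₀ :=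
    Real.rpow_logb two_pos (by norm_num) (by linarith)
  rw [h1B, h2C, ← div_eq_mul_inv P a]
  have hpos : 0 < 1 + P / a := by positivity
  have hsM : ∀ s, s ≤ Real.logb 2 (1 + P / a) ↔ (2 : ℝ) ^ s - 1 ≤ P / a := fun s => by
    rw [Real.le_logb_iff_rpow_le one_lt_two hpos, sub_le_iff_le_add']
  have hu : ∀ s : ℝ, 0 ≤ s → 0 ≤ (2 : ℝ) ^ s - 1 := fun s hs => by
    linarith [Real.one_le_rpow one_le_two hs]
  have hsnrB : ∀ u, u ≤ P / a → a * u ≤ P := fun u h => by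
    rwa [le_div_iff₀ ha, mul_comm] at h
  have hsnrC : ∀ u, 0 ≤ u → u ≤ P / a → a' * u ≤ P := fun u h h' =>
    (mul_le_mul_of_nonneg_right haa'.le h).trans (hsnrB u h')
  have hRB : ∀ s, 0 ≤ s → s ≤ Real.logb 2 (1 + P / a) →
      R2 D H β0 P xB s = Real.logb 2 (1 + paretoSNR P a b ((2 : ℝ) ^ s - 1)) := fun s hs h =>
    R2_eq_logb_paretoSNR ha hb h1B h2B hs (hsnrB _ ((hsM s).1 h))
  have hRC : ∀ s, 0 ≤ s → s ≤ Real.logb 2 (1 + P / a) →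
      R2 D H β0 P xC s = Real.logb 2 (1 + paretoSNR P a' b' ((2 : ℝ) ^ s - 1)) := fun s hs h =>
    R2_eq_logb_paretoSNR ha' hb' h1C h2C hs (hsnrC _ (hu s hs) ((hsM s).1 h))
  have hrb0 : 0 < Real.logb 2 (1 + u₀) := Real.logb_pos one_lt_two (by linarith)
  have hrbM : Real.logb 2 (1 + u₀) < Real.logb 2 (1 + P / a) :=
    Real.logb_lt_logb one_lt_two (by linarith) (by linarith)
  have hL : ∀ s : ℝ, 0 ≤ s → s < Real.logb 2 (1 + u₀) → R2 D H β0 P xC s < R2 D H β0 P xB s := by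
    intro s hs hlt'
    have hle := hlt'.le.trans hrbM.le
    rw [hRB s hs hle, hRC s hs hle]
    have := paretoSNR_nonneg ha' hb' (hu s hs) (hsnrC _ (hu s hs) ((hsM s).1 hle))
    rw [Real.lt_logb_iff_rpow_lt one_lt_two (by linarith)] at hlt'
    exact Real.logb_lt_logb one_lt_two (by linarith)
      (add_lt_add_right (hleft _ (hu s hs) (by linarith)) 1)
  have hR : ∀ s : ℝ, Real.logb 2 (1 + u₀) < s → s ≤ Real.logb 2 (1 + P / a) →
      R2 D H β0 P xB s < R2 D H β0 P xC s := by
    intro s hlt' hle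
    have hs := (hrb0.trans hlt').le
    rw [hRB s hs hle, hRC s hs hle]
    have := paretoSNR_nonneg ha hb (hu s hs) (hsnrB _ ((hsM s).1 hle))
    rw [Real.logb_lt_iff_lt_rpow one_lt_two (by linarith)] at hlt'
    exact Real.logb_lt_logb one_lt_two (by linarith)
      (add_lt_add_right (hright _ (by linarith) ((hsM s).1 hle)) 1)
  have hB₀ : R2 D H β0 P xB (Real.logb 2 (1 + u₀)) = Real.logb 2 (1 + paretoSNR P a b u₀) := by
    rw [hRB _ hrb0.le hrbM.le, hs₀, add_sub_cancel_left]
  have hC₀ : R2 D H β0 P xC (Real.logb 2 (1 + u₀)) = Real.logb 2 (1 + paretoSNR P a' b' u₀) := by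
    rw [hRC _ hrb0.le hrbM.le, hs₀, add_sub_cancel_left]
  have hv : 0 < paretoSNR P a b u₀ :=
    paretoSNR_pos ha hb hu0.le (by rwa [lt_div_iff₀ ha, mul_comm] at hlt)
  refine ⟨Real.logb 2 (1 + u₀), hrb0, hrbM, by rw [hB₀, hC₀, heq], fun s hs hsM' hEq => ?_, ?_, ?_,
    hL, hR⟩
  · rcases lt_trichotomy s (Real.logb 2 (1 + u₀)) with h | h | h
    · exact absurd hEq (hL s hs.le h).ne'
    · exact h
    · exact absurd hEq (hR s h hsM'.le).ne
  · rw [hB₀]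
    exact Real.logb_pos one_lt_two (by linarith)
  · rw [hB₀]
    refine Real.logb_lt_logb one_lt_two (by linarith) (add_lt_add_right ?_ 1)
    rw [heq]
    exact paretoSNR_lt ha' hb' hP hu0
end

section
/- Let P̄ > 0 and let h1B, h1C, h2B, h2C be real numbers with h2B > h2C > h1C > h1B > 0. Then w* = 1 + P̄·h1B·h1C·(h2B − h2C)/(h2B·h1C − h1B·h2C) is well defined (the denominator is positive), satisfies w* > 1, and is the unique real number w > 0 satisfying (P̄·h1B − w + 1)·h2B/(w·h1B) = (P̄·h1C − w + 1)·h2C/(w·h1C). -/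
/-- The intersection equation is linear in `w` after clearing denominators. -/
theorem intersection_eq_iff {P b c B C w : ℝ} (hb : b ≠ 0) (hc : c ≠ 0) (hw : w ≠ 0)
    (hD : B * c - b * C ≠ 0) :
    (P * b - w + 1) * B / (w * b) = (P * c - w + 1) * C / (w * c) ↔
      w = 1 + P * b * c * (B - C) / (B * c - b * C) := by
  rw [div_eq_div_iff (mul_ne_zero hw hb) (mul_ne_zero hw hc), ← sub_eq_iff_eq_add',
    eq_div_iff hD, ← mul_right_inj' hw (b := (w - 1) * _)]
  constructor <;> intro h <;> linear_combination -h

/-- Equation (33): with `h2B > h2C > h1C > h1B > 0` and `P̄ > 0`,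
the quantity `w* = 1 + P̄ h1B h1C (h2B - h2C) / (h2B h1C - h1B h2C)` is well defined
(positive denominator), satisfies `w* > 1`, and is the unique `w > 0` with
`(P̄ h1B - w + 1) h2B / (w h1B) = (P̄ h1C - w + 1) h2C / (w h1C)`. -/
theorem intersection_same_side (P h1B h1C h2B h2C : ℝ)
    (hP : 0 < P) (h1 : h2C < h2B) (h2 : h1C < h2C) (h3 : h1B < h1C) (h4 : 0 < h1B) :
    0 < h2B * h1C - h1B * h2C ∧
    1 < 1 + P * h1B * h1C * (h2B - h2C) / (h2B * h1C - h1B * h2C) ∧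
    (let w := 1 + P * h1B * h1C * (h2B - h2C) / (h2B * h1C - h1B * h2C)
     (P * h1B - w + 1) * h2B / (w * h1B) = (P * h1C - w + 1) * h2C / (w * h1C)) ∧
    (∀ w : ℝ, 0 < w →
      (P * h1B - w + 1) * h2B / (w * h1B) = (P * h1C - w + 1) * h2C / (w * h1C) →
      w = 1 + P * h1B * h1C * (h2B - h2C) / (h2B * h1C - h1B * h2C)) := by
  have hc : 0 < h1C := h4.trans h3
  have hC : 0 < h2C := hc.trans h2
  have hD : 0 < h2B * h1C - h1B * h2C := by
    rw [sub_pos, mul_comm h1B]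
    exact mul_lt_mul'' h1 h3 hC.le h4.le
  have hw : 1 < 1 + P * h1B * h1C * (h2B - h2C) / (h2B * h1C - h1B * h2C) := by
    have := sub_pos.2 h1
    exact lt_add_of_pos_right 1 (by positivity)
  exact ⟨hD, hw,
    (intersection_eq_iff h4.ne' hc.ne' (zero_lt_one.trans hw).ne' hD.ne').2 rfl,
    fun w hw₀ h => (intersection_eq_iff h4.ne' hc.ne' hw₀.ne' hD.ne').1 h⟩
end

section
/- Let P̄ > 0 and let h1B, h2B, h1C, h2C be real numbers with h2B > h1B > 0, h1C > h2C > 0, h2B > h2C, and h1C > h1B. Then there exists exactly one real number w > 1 satisfying (P̄·h2C + 1)·h1C/((w − 1)·h2C + h1C) − (P̄·h1B + 1)·h2B/(w·h1B) + h2B/h1B − 1 = 0. -/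
/-- A real quadratic with positive leading coefficient and negative constant term has exactly one
positive root. -/
theorem existsUnique_pos_root_quadratic {A B C : ℝ} (hA : 0 < A) (hC : C < 0) :
    ∃! t : ℝ, 0 < t ∧ A * t ^ 2 + B * t + C = 0 := by
  have hAC : A * C < 0 := mul_neg_of_pos_of_neg hA hC
  have hdisc : 0 ≤ B ^ 2 - 4 * A * C := by nlinarith [sq_nonneg B]
  have hsq := Real.sq_sqrt hdisc
  have hlt : B < √(B ^ 2 - 4 * A * C) := Real.lt_sqrt_of_sq_lt (by linarith)
  refine ⟨(√(B ^ 2 - 4 * A * C) - B) / (2 * A), ⟨div_pos (by linarith) (by linarith), ?_⟩, ?_⟩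
  · generalize √(B ^ 2 - 4 * A * C) = s at hsq ⊢
    field_simp
    linear_combination hsq
  · rintro t ⟨ht, hroot⟩
    have hpos : 0 < 2 * A * t + B := by
      have : 0 < t * (A * t + B) := by linarith
      have := pos_of_mul_pos_right this ht.le
      nlinarith [mul_pos hA ht]
    have hval : √(B ^ 2 - 4 * A * C) = 2 * A * t + B := by
      rw [← Real.sqrt_sq hpos.le]
      congr 1
      linear_combination (-4 * A) * hroot
    rw [hval]
    field_simp
    ring

/-- Equation (38): with `h2B > h1B > 0`, `h1C > h2C > 0`,
`h2B > h2C`, and `h1C > h1B`, there is exactly one real `w > 1` with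
`(P̄ h2C + 1) h1C / ((w - 1) h2C + h1C) - (P̄ h1B + 1) h2B / (w h1B) + h2B/h1B - 1 = 0`. -/
theorem intersection_opposite_sides (P h1B h2B h1C h2C : ℝ)
    (hP : 0 < P) (hB : h1B < h2B) (hB0 : 0 < h1B)
    (hC : h2C < h1C) (hC0 : 0 < h2C) (h2 : h2C < h2B) (h1 : h1B < h1C) :
    ∃! w : ℝ, 1 < w ∧
      (P * h2C + 1) * h1C / ((w - 1) * h2C + h1C) -
        (P * h1B + 1) * h2B / (w * h1B) + h2B / h1B - 1 = 0 := by
  have hquad : ∀ t : ℝ, 0 < t →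
      ((P * h2C + 1) * h1C / (t * h2C + h1C) -
          (P * h1B + 1) * h2B / ((t + 1) * h1B) + h2B / h1B - 1 = 0 ↔
        (h2B - h1B) * h2C * t ^ 2 +
            ((P * h2C + 1) * h1C * h1B - (P * h1B + 1) * h2B * h2C +
              (h2B - h1B) * (h1C + h2C)) * t +
          P * h1B * h1C * (h2C - h2B) = 0) := by
    intro t ht
    have hD : t * h2C + h1C ≠ 0 := by nlinarith [mul_pos ht hC0]
    have ht1 : t + 1 ≠ 0 := by linarith
    have ha : h1B ≠ 0 := hB0.ne'
    have hmul : (t + 1) * h1B * (t * h2C + h1C) *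
        ((P * h2C + 1) * h1C / (t * h2C + h1C) -
          (P * h1B + 1) * h2B / ((t + 1) * h1B) + h2B / h1B - 1) =
        (h2B - h1B) * h2C * t ^ 2 +
            ((P * h2C + 1) * h1C * h1B - (P * h1B + 1) * h2B * h2C +
              (h2B - h1B) * (h1C + h2C)) * t +
          P * h1B * h1C * (h2C - h2B) := by
      field_simp
      ring
    rw [← hmul, mul_eq_zero_iff_left (mul_ne_zero (mul_ne_zero ht1 ha) hD)]
  obtain ⟨t, ⟨ht, hroot⟩, huniq⟩ := existsUnique_pos_root_quadratic
    (B := (P * h2C + 1) * h1C * h1B - (P * h1B + 1) * h2B * h2C + (h2B - h1B) * (h1C + h2C))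
    (mul_pos (sub_pos.2 hB) hC0)
    (mul_neg_of_pos_of_neg (mul_pos (mul_pos hP hB0) (hB0.trans h1)) (sub_neg.2 h2))
  refine ⟨t + 1, ⟨by linarith, ?_⟩, ?_⟩
  · simpa only [add_sub_cancel_right] using (hquad t ht).2 hroot
  · rintro w ⟨hw, heq⟩
    have hw0 : 0 < w - 1 := sub_pos.2 hw
    have := huniq (w - 1) ⟨hw0, (hquad _ hw0).1 (by simpa only [sub_add_cancel] using heq)⟩
    linarith
end

section
/- Let V > 0. For every (r1, r2) ∈ C_TD(V,T,P̄) there exist -D/2 ≤ x_I ≤ x_F ≤ D/2 and t_I, t_F ≥ 0 with t_I + (x_F − x_I)/V + t_F = T, satisfying: t_I > 0 implies x_I = -D/2, and t_F > 0 implies x_F = D/2 (equivalently: if -D/2 < x_I ≤ x_F < D/2 then t_I = t_F = 0 and V·T = x_F − x_I; if x_I = -D/2 and x_F < D/2 then t_F = 0; if x_I > -D/2 and x_F = D/2 then t_I = 0; and if x_I = -D/2 and x_F = D/2 then t_I + t_F + D/V = T), such that some pair (r1', r2') with r1' ≥ r1 and r2' ≥ r2 is TDMA-achievable for the HFH trajectory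 determined by (x_I, x_F, t_I, t_F) with some TDMA schedule. That is, under TDMA-based transmission the optimal UAV trajectory is hover-fly-hover with hovering only possible at the points above the two users. -/
open MeasureTheory

/-- The hover-fly-hover (HFH) trajectory: hover at `xI` during `[0, tI]`, fly at
speed `V` during `(tI, T - tF)`, hover at `xF` during `[T - tF, T]`. -/
noncomputable def hfh (V T xI xF tI tF : ℝ) : ℝ → ℝ := fun t =>
  if t ≤ tI then xI else if t < T - tF then xI + V * (t - tI) else xF

/-- A TDMA schedule: measurable `{0,1}`-valued indicator functions with at most
one user scheduled at each time. -/
def TDMASchedule (T : ℝ) (π1 π2 : ℝ → ℝ) : Prop :=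
  Measurable π1 ∧ Measurable π2 ∧
    ∀ t ∈ Set.Icc (0 : ℝ) T,
      (π1 t = 0 ∨ π1 t = 1) ∧ (π2 t = 0 ∨ π2 t = 1) ∧ π1 t + π2 t ≤ 1

/-- The rate pair `(r1, r2)` is TDMA-achievable for trajectory `x` and schedule
`(π1, π2)` with full power `P` to the scheduled user. -/
def TDMAAchievable (D H β0 P T : ℝ) (x π1 π2 : ℝ → ℝ) (r1 r2 : ℝ) : Prop :=
  0 ≤ r1 ∧ 0 ≤ r2 ∧
    r1 ≤ (1 / T) * ∫ t in (0 : ℝ)..T, π1 t * Real.logb 2 (1 + P * h1 D H β0 (x t)) ∧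
    r2 ≤ (1 / T) * ∫ t in (0 : ℝ)..T, π2 t * Real.logb 2 (1 + P * h2 D H β0 (x t))

/-- The TDMA achievable rate region `C_TD(V, T, P)`. -/
def CTD (D H β0 P V T : ℝ) : Set (ℝ × ℝ) :=
  {r | ∃ x π1 π2, FeasibleTraj V T x ∧ TDMASchedule T π1 π2 ∧
    TDMAAchievable D H β0 P T x π1 π2 r.1 r.2}

/-- A Lipschitz function that passes from below `w` to above `c` on `[0, T]` spends time at
least `(c - w) / V` strictly between the two levels. -/
lemma ofReal_div_le_volume_crossing {V T w c t₁ t₂ : ℝ} {X : ℝ → ℝ} (hV : 0 < V)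
    (hX : LipschitzWith V.toNNReal X) (ht₁ : t₁ ∈ Set.Icc 0 T) (ht₂ : t₂ ∈ Set.Icc 0 T)
    (h₁ : X t₁ ≤ w) (h₂ : c ≤ X t₂) :
    ENNReal.ofReal ((c - w) / V) ≤ volume (Set.Icc 0 T ∩ X ⁻¹' Set.Ioo w c) := by
  have hsub : Set.Ioo w c ⊆ X '' (Set.Icc 0 T ∩ X ⁻¹' Set.Ioo w c) := by
    intro u hu
    obtain ⟨t, ht, rfl⟩ := isPreconnected_Icc.intermediate_value ht₁ ht₂
      hX.continuous.continuousOn ⟨h₁.trans hu.1.le, hu.2.le.trans h₂⟩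
    exact ⟨t, ⟨ht, hu⟩, rfl⟩
  have himage : volume (X '' (Set.Icc 0 T ∩ X ⁻¹' Set.Ioo w c)) ≤
      ENNReal.ofReal V * volume (Set.Icc 0 T ∩ X ⁻¹' Set.Ioo w c) := by
    have h := (hX.lipschitzOnWith (s := Set.Icc 0 T ∩ X ⁻¹' Set.Ioo w c)).hausdorffMeasure_image_le
      zero_le_one
    rwa [hausdorffMeasure_real, ENNReal.rpow_one] at h
  have h := (measure_mono hsub).trans himage
  rw [Real.volume_Ioo] at h
  rw [ENNReal.ofReal_div_of_pos hV]
  exact ENNReal.div_le_of_le_mul' h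

/-- A continuous function on `[0, T]` has an `s`-quantile between two of its values. -/
lemma exists_quantile {T s : ℝ} {X : ℝ → ℝ} (hX : Continuous X) (hs : 0 ≤ s) (hsT : s ≤ T) :
    ∃ c, (∃ t ∈ Set.Icc 0 T, X t ≤ c) ∧ (∃ t ∈ Set.Icc 0 T, c ≤ X t) ∧
      volume (Set.Icc 0 T ∩ X ⁻¹' Set.Iio c) ≤ ENNReal.ofReal s ∧
      volume (Set.Icc 0 T ∩ X ⁻¹' Set.Ioi c) ≤ ENNReal.ofReal (T - s) := by
  have hne : (Set.Icc 0 T).Nonempty := Set.nonempty_Icc.2 (hs.trans hsT)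
  obtain ⟨a, ha, hmin⟩ := isCompact_Icc.exists_isMinOn hne hX.continuousOn
  obtain ⟨b, hb, hmax⟩ := isCompact_Icc.exists_isMaxOn hne hX.continuousOn
  rw [isMinOn_iff] at hmin
  rw [isMaxOn_iff] at hmax
  set S : Set ℝ := {u | volume (Set.Icc 0 T ∩ X ⁻¹' Set.Iio u) ≤ ENNReal.ofReal s ∧ u ≤ X b}
    with hS
  have haS : X a ∈ S := by
    refine ⟨?_, hmin b hb⟩
    have : Set.Icc 0 T ∩ X ⁻¹' Set.Iio (X a) = ∅ := by
      ext t
      simp only [Set.mem_inter_iff, Set.mem_preimage, Set.mem_Iio, Set.mem_empty_iff_false,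
        iff_false, not_and, not_lt]
      exact hmin t
    simp [this]
  have hbdd : BddAbove S := ⟨X b, fun u hu => hu.2⟩
  refine ⟨sSup S, ⟨a, ha, le_csSup hbdd haS⟩, ⟨b, hb, csSup_le ⟨_, haS⟩ fun u hu => hu.2⟩, ?_, ?_⟩
  · have hU : Set.Icc 0 T ∩ X ⁻¹' Set.Iio (sSup S) =
        ⋃ n : ℕ, Set.Icc 0 T ∩ X ⁻¹' Set.Iio (sSup S - 1 / ((n : ℝ) + 1)) := by
      ext t
      simp only [Set.mem_inter_iff, Set.mem_preimage, Set.mem_Iio, Set.mem_iUnion,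
        exists_and_left, and_congr_right_iff]
      intro _
      constructor
      · intro h
        obtain ⟨n, hn⟩ := exists_nat_one_div_lt (sub_pos.2 h)
        exact ⟨n, by linarith⟩
      · rintro ⟨n, hn⟩
        have : 0 < 1 / ((n : ℝ) + 1) := by positivity
        linarith
    rw [hU, Monotone.measure_iUnion]
    · refine iSup_le fun n => ?_
      have hn : 0 < 1 / ((n : ℝ) + 1) := by positivity
      obtain ⟨u, hu, hlt⟩ := exists_lt_of_lt_csSup ⟨_, haS⟩ (sub_lt_self (sSup S) hn)
      exact (measure_mono (Set.inter_subset_inter_right _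
        (Set.preimage_mono (Set.Iio_subset_Iio hlt.le)))).trans hu.1
    · intro m n hmn
      exact Set.inter_subset_inter_right _ (Set.preimage_mono (Set.Iio_subset_Iio
        (sub_le_sub_left (Nat.one_div_le_one_div hmn) _)))
  · have hU : Set.Icc 0 T ∩ X ⁻¹' Set.Ioi (sSup S) =
        ⋃ n : ℕ, Set.Icc 0 T ∩ X ⁻¹' Set.Ici (sSup S + 1 / ((n : ℝ) + 1)) := by
      ext t
      simp only [Set.mem_inter_iff, Set.mem_preimage, Set.mem_Ioi, Set.mem_Ici, Set.mem_iUnion,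
        exists_and_left, and_congr_right_iff]
      intro _
      constructor
      · intro h
        obtain ⟨n, hn⟩ := exists_nat_one_div_lt (sub_pos.2 h)
        exact ⟨n, by linarith⟩
      · rintro ⟨n, hn⟩
        have : 0 < 1 / ((n : ℝ) + 1) := by positivity
        linarith
    rw [hU, Monotone.measure_iUnion]
    · refine iSup_le fun n => ?_
      have hn : 0 < 1 / ((n : ℝ) + 1) := by positivity
      set u := sSup S + 1 / ((n : ℝ) + 1) with hu
      have huS : u ∉ S := fun h => by linarith [le_csSup hbdd h]
      rcases le_or_gt u (X b) with hub | hub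
      · have hlt : ENNReal.ofReal s < volume (Set.Icc 0 T ∩ X ⁻¹' Set.Iio u) := by
          by_contra! h
          exact huS ⟨h, hub⟩
        have hadd := measure_inter_add_sdiff (μ := volume) (Set.Icc 0 T)
          (hX.measurable (measurableSet_Iio (a := u)))
        have hdiff : Set.Icc 0 T \ X ⁻¹' Set.Iio u = Set.Icc 0 T ∩ X ⁻¹' Set.Ici u := by
          ext t; simp
        rw [hdiff, Real.volume_Icc, sub_zero] at hadd
        rw [ENNReal.ofReal_sub _ hs, ← hadd]
        refine ENNReal.le_sub_of_add_le_left ENNReal.ofReal_ne_top ?_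
        gcongr
      · have : Set.Icc 0 T ∩ X ⁻¹' Set.Ici u = ∅ := by
          ext t
          simp only [Set.mem_inter_iff, Set.mem_preimage, Set.mem_Ici, Set.mem_empty_iff_false,
            iff_false, not_and, not_le]
          exact fun ht => (hmax t ht).trans_lt hub
        simp [this]
    · intro m n hmn
      exact Set.inter_subset_inter_right _ (Set.preimage_mono (Set.Ici_subset_Ici.2
        (add_le_add_right (Nat.one_div_le_one_div hmn) _)))

/-- Rearrangement bound: serving a user whose rate `g` decreases with the position, during a set
of times of measure at most `s`, is no better than serving it during `(0, s]` along a trajectory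
that approaches the quantile `c` at full speed from the left. -/
lemma setIntegral_le_of_quantile {V T s L c : ℝ} {X Y g : ℝ → ℝ} {A : Set ℝ} (hV : 0 < V)
    (hX : LipschitzWith V.toNNReal X) (hXL : ∀ t, L ≤ X t) (hY : Continuous Y)
    (hYL : ∀ t, L ≤ Y t) (hYle : ∀ t ≤ s, Y t ≤ max L (c - V * (s - t)))
    (hg : Continuous g) (hg0 : ∀ u, 0 ≤ g u) (hanti : AntitoneOn g (Set.Ici L))
    (hc : ∃ t ∈ Set.Icc 0 T, c ≤ X t)
    (hquant : volume (Set.Icc 0 T ∩ X ⁻¹' Set.Iio c) ≤ ENNReal.ofReal s)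
    (hAT : A ⊆ Set.Icc 0 T) (hAs : volume A ≤ ENNReal.ofReal s) :
    ∫ t in A, g (X t) ≤ ∫ t in Set.Ioc 0 s, g (Y t) := by
  have hgX : Continuous fun t => g (X t) := hg.comp hX.continuous
  have hgY : Continuous fun t => g (Y t) := hg.comp hY
  have hintY : IntegrableOn (fun t => g (Y t)) (Set.Ioc 0 s) :=
    (hgY.integrableOn_Icc).mono_set Set.Ioc_subset_Icc_self
  rw [integral_eq_lintegral_of_nonneg_ae (Filter.Eventually.of_forall fun t => hg0 _)
      hgX.aestronglyMeasurable,
    integral_eq_lintegral_of_nonneg_ae (Filter.Eventually.of_forall fun t => hg0 _)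
      hgY.aestronglyMeasurable]
  refine ENNReal.toReal_mono ?_ ?_
  · exact ((lintegral_ofReal_le_lintegral_enorm _).trans_lt hintY.hasFiniteIntegral).ne
  rw [lintegral_eq_lintegral_meas_le _ (Filter.Eventually.of_forall fun t => hg0 _)
      hgX.measurable.aemeasurable,
    lintegral_eq_lintegral_meas_le _ (Filter.Eventually.of_forall fun t => hg0 _)
      hgY.measurable.aemeasurable]
  refine lintegral_mono fun z => ?_
  rw [Measure.restrict_apply (measurableSet_le measurable_const hgX.measurable),
    Measure.restrict_apply (measurableSet_le measurable_const hgY.measurable)]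
  set B : Set ℝ := Set.Icc 0 T ∩ {t | z ≤ g (X t)} with hB
  have hsub : {t | z ≤ g (X t)} ∩ A ⊆ B := fun t ht => ⟨hAT ht.2, ht.1⟩
  rcases B.eq_empty_or_nonempty with hemp | hne
  · rw [Set.subset_empty_iff.1 (hsub.trans hemp.subset)]
    simp
  have hBc : IsCompact B := isCompact_Icc.inter_right (isClosed_le continuous_const hgX)
  obtain ⟨t₁, ht₁, hmax⟩ := hBc.exists_isMaxOn hne hX.continuous.continuousOn
  rw [isMaxOn_iff] at hmax
  have hlevel : ∀ t, Y t ≤ X t₁ → z ≤ g (Y t) := fun t ht =>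
    ht₁.2.trans (hanti (hYL t) (hXL t₁) ht)
  rcases le_or_gt c (X t₁) with hcw | hwc
  · calc volume ({t | z ≤ g (X t)} ∩ A) ≤ volume A := measure_mono Set.inter_subset_right
      _ ≤ ENNReal.ofReal s := hAs
      _ = volume (Set.Ioc 0 s) := by simp
      _ ≤ _ := measure_mono fun t ht => ?_
    refine ⟨hlevel t ?_, ht⟩
    refine (hYle t ht.2).trans (max_le (hXL t₁) ?_)
    nlinarith [mul_nonneg hV.le (sub_nonneg.2 ht.2)]
  · obtain ⟨t₂, ht₂, hct₂⟩ := hc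
    have hcross := ofReal_div_le_volume_crossing hV hX ht₁.1 ht₂ le_rfl hct₂
    have hdisj : Disjoint ({t | z ≤ g (X t)} ∩ A)
        (Set.Icc 0 T ∩ X ⁻¹' Set.Ioo (X t₁) c) := by
      rw [Set.disjoint_left]
      intro t ht ht'
      exact absurd (hmax t (hsub ht)) (not_le.2 ht'.2.1)
    have hsum : volume ({t | z ≤ g (X t)} ∩ A) + ENNReal.ofReal ((c - X t₁) / V) ≤
        ENNReal.ofReal s := by
      refine (add_le_add_right hcross _).trans (le_trans ?_ hquant)
      rw [← measure_union hdisj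
        (measurableSet_Icc.inter (hX.continuous.measurable measurableSet_Ioo))]
      refine measure_mono (Set.union_subset (fun t ht => ⟨hAT ht.2, ?_⟩)
        (fun t ht => ⟨ht.1, ht.2.2⟩))
      exact (hmax t (hsub ht)).trans_lt hwc
    have hpos : 0 ≤ (c - X t₁) / V := div_nonneg (sub_nonneg.2 hwc.le) hV.le
    calc volume ({t | z ≤ g (X t)} ∩ A)
        ≤ ENNReal.ofReal s - ENNReal.ofReal ((c - X t₁) / V) :=
          ENNReal.le_sub_of_add_le_right ENNReal.ofReal_ne_top hsum
      _ = volume (Set.Ioc 0 (s - (c - X t₁) / V)) := by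
          rw [← ENNReal.ofReal_sub _ hpos, Real.volume_Ioc, sub_zero]
      _ ≤ _ := measure_mono fun t ht => ?_
    have hts : t ≤ s := ht.2.trans (sub_le_self _ hpos)
    refine ⟨hlevel t ((hYle t hts).trans (max_le (hXL t₁) ?_)), ht.1, hts⟩
    have h : (c - X t₁) / V ≤ s - t := by linarith [ht.2]
    rw [div_le_iff₀ hV] at h
    linarith

lemma continuous_rate {D H β0 P : ℝ} (hH : 0 < H) (hβ : 0 < β0) (hP : 0 < P) :
    Continuous fun u => Real.logb 2 (1 + P * h1 D H β0 u) := by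
  have hden : ∀ u : ℝ, 0 < (u + D / 2) ^ 2 + H ^ 2 := fun u => by positivity
  have hh1 : Continuous fun u => h1 D H β0 u :=
    continuous_const.div (by fun_prop) fun u => (hden u).ne'
  refine Continuous.logb (by fun_prop) fun u => ?_
  have : 0 < h1 D H β0 u := div_pos hβ (hden u)
  positivity

lemma rate_nonneg {D H β0 P : ℝ} (hβ : 0 < β0) (hP : 0 < P) (u : ℝ) :
    0 ≤ Real.logb 2 (1 + P * h1 D H β0 u) := by
  have : 0 ≤ h1 D H β0 u := by unfold h1; positivity
  exact Real.logb_nonneg one_lt_two (le_add_of_nonneg_right (by positivity))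

lemma rate_le_rate {D H β0 P u v : ℝ} (hH : 0 < H) (hβ : 0 < β0) (hP : 0 < P)
    (huv : |u + D / 2| ≤ |v + D / 2|) :
    Real.logb 2 (1 + P * h1 D H β0 v) ≤ Real.logb 2 (1 + P * h1 D H β0 u) := by
  have hv : 0 ≤ h1 D H β0 v := by unfold h1; positivity
  have hle : h1 D H β0 v ≤ h1 D H β0 u := by
    have := sq_le_sq.2 huv
    unfold h1
    gcongr
  refine Real.logb_le_logb_of_le one_lt_two (by positivity) ?_
  gcongr

lemma antitoneOn_rate {D H β0 P : ℝ} (hH : 0 < H) (hβ : 0 < β0) (hP : 0 < P) :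
    AntitoneOn (fun u => Real.logb 2 (1 + P * h1 D H β0 u)) (Set.Ici (-(D / 2))) := by
  intro u hu v hv huv
  rw [Set.mem_Ici] at hu hv
  refine rate_le_rate hH hβ hP ?_
  rw [abs_of_nonneg (by linarith), abs_of_nonneg (by linarith)]
  linarith

lemma h2_eq_h1_neg (D H β0 u : ℝ) : h2 D H β0 u = h1 D H β0 (-u) := by
  unfold h1 h2
  congr 2
  ring

/-- Projecting a position to the segment between the users brings it closer to user 1. -/
lemma abs_clamp_add_le (D u : ℝ) :
    |max (-(D / 2)) (min (D / 2) u) + D / 2| ≤ |u + D / 2| := by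
  rw [abs_of_nonneg (by linarith [le_max_left (-(D / 2)) (min (D / 2) u)])]
  rcases le_total (-(D / 2)) u with h | h
  · rw [abs_of_nonneg (by linarith)]
    have := max_le h (min_le_right (D / 2) u)
    linarith
  · have : max (-(D / 2)) (min (D / 2) u) = -(D / 2) :=
      max_eq_left ((min_le_right _ _).trans h)
    rw [this]
    simp

lemma neg_clamp {D : ℝ} (hD : 0 < D) (u : ℝ) :
    -max (-(D / 2)) (min (D / 2) u) = max (-(D / 2)) (min (D / 2) (-u)) := by
  rw [← min_neg_neg, neg_neg, ← max_neg_neg, max_min_distrib_left,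
    max_eq_right (by linarith : -(D / 2) ≤ D / 2)]

/-- A full-speed flight through `c ∈ [-D/2, D/2]` at time `s`, clamped to the segment between
the users, is a hover-fly-hover trajectory hovering only above the users. -/
lemma exists_hfh_eq_clamp {D V T s c : ℝ} (hV : 0 < V) (hs : 0 ≤ s)
    (hsT : s ≤ T) (hLc : -(D / 2) ≤ c) (hcR : c ≤ D / 2) :
    ∃ xI xF tI tF : ℝ,
      -(D / 2) ≤ xI ∧ xI ≤ xF ∧ xF ≤ D / 2 ∧
      0 ≤ tI ∧ 0 ≤ tF ∧ tI + (xF - xI) / V + tF = T ∧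
      (0 < tI → xI = -(D / 2)) ∧ (0 < tF → xF = D / 2) ∧
      ∀ t ∈ Set.Icc 0 T,
        hfh V T xI xF tI tF t = max (-(D / 2)) (min (D / 2) (c + V * (t - s))) := by
  obtain ⟨tI, xI, htI, hxI, hI, hmI, hI'⟩ : ∃ tI xI : ℝ, 0 ≤ tI ∧ -(D / 2) ≤ xI ∧
      xI = c + V * (tI - s) ∧ tI ≤ s ∧ (0 < tI → xI = -(D / 2)) := by
    rcases le_total (-(D / 2)) (c - V * s) with h | h
    · exact ⟨0, c - V * s, le_rfl, h, by ring, hs, fun h => absurd h (lt_irrefl _)⟩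
    · refine ⟨s - (c + D / 2) / V, -(D / 2), ?_, le_rfl, ?_, ?_, fun _ => rfl⟩
      · rw [sub_nonneg, div_le_iff₀ hV]; linarith
      · field_simp; ring
      · exact sub_le_self _ (div_nonneg (by linarith) hV.le)
  obtain ⟨tF, xF, htF, hxF, hF, hmF, hF'⟩ : ∃ tF xF : ℝ, 0 ≤ tF ∧ xF ≤ D / 2 ∧
      xF = c + V * (T - tF - s) ∧ s ≤ T - tF ∧ (0 < tF → xF = D / 2) := by
    rcases le_total (c + V * (T - s)) (D / 2) with h | h
    · exact ⟨0, c + V * (T - s), le_rfl, h, by ring, by linarith,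
        fun h => absurd h (lt_irrefl _)⟩
    · have hdiv : (D / 2 - c) / V ≤ T - s := by rw [div_le_iff₀ hV]; linarith
      refine ⟨T - s - (D / 2 - c) / V, D / 2, by linarith, le_rfl, ?_, ?_, fun _ => rfl⟩
      · field_simp; ring
      · linarith [div_nonneg (sub_nonneg.2 hcR) hV.le]
  have hIF : xI ≤ xF := by
    rw [hI, hF]
    have : V * (tI - s) ≤ V * (T - tF - s) := by gcongr; linarith
    linarith
  refine ⟨xI, xF, tI, tF, hxI, hIF, hxF, htI, htF, ?_, hI', hF', fun t ht => ?_⟩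
  · rw [hI, hF]; field_simp; ring
  unfold hfh
  split_ifs with h₁ h₂
  · rcases htI.eq_or_lt with h0 | h0
    · have : t = tI := le_antisymm h₁ (h0 ▸ ht.1)
      rw [this, ← hI, min_eq_right (hIF.trans hxF), max_eq_right hxI]
    · have : V * (t - s) ≤ V * (tI - s) := by gcongr
      rw [hI' h0, max_eq_left ((min_le_right _ _).trans (by linarith [hI' h0]))]
  · rw [not_le] at h₁
    have hl : V * (tI - s) ≤ V * (t - s) := by gcongr
    have hr : V * (t - s) ≤ V * (T - tF - s) := by gcongr
    rw [min_eq_right (by linarith), max_eq_right (by linarith), hI]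
    ring
  · rw [not_lt] at h₂
    rcases htF.eq_or_lt with h0 | h0
    · have : t = T - tF := le_antisymm (by rw [← h0, sub_zero]; exact ht.2) h₂
      rw [this, ← hF, min_eq_right hxF, max_eq_right (hxI.trans hIF)]
    · have : V * (T - tF - s) ≤ V * (t - s) := by gcongr
      rw [hF' h0, min_eq_left (by linarith [hF' h0]), max_eq_right (by linarith)]

/-- A feasible trajectory, clamped to `[-D/2, D/2]`, extends to a Lipschitz function on `ℝ`. -/
lemma FeasibleTraj.exists_lipschitz_clamp {D V T : ℝ} {x : ℝ → ℝ} (hx : FeasibleTraj V T x)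
    (hD : 0 < D) (hV : 0 < V) :
    ∃ X : ℝ → ℝ, LipschitzWith V.toNNReal X ∧ (∀ t, X t ∈ Set.Icc (-(D / 2)) (D / 2)) ∧
      ∀ t ∈ Set.Icc 0 T, X t = max (-(D / 2)) (min (D / 2) (x t)) := by
  have hlip : LipschitzOnWith V.toNNReal x (Set.Icc 0 T) :=
    LipschitzOnWith.of_dist_le_mul fun s hs t ht => by
      rw [Real.coe_toNNReal _ hV.le]
      exact hx s hs t ht
  obtain ⟨x', hx', heq⟩ := hlip.extend_real
  refine ⟨fun t => max (-(D / 2)) (min (D / 2) (x' t)),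
    (hx'.const_min (D / 2)).const_max (-(D / 2)),
    fun t => ⟨le_max_left _ _, max_le (by linarith) (min_le_left _ _)⟩, fun t ht => ?_⟩
  simp only [heq ht]

/-- The integral of a rate gated by a `{0, 1}`-valued schedule is at most its integral, along any
better trajectory, over the scheduled times. -/
lemma intervalIntegral_schedule_le {T : ℝ} {p f F : ℝ → ℝ} (hT : 0 ≤ T) (hp : Measurable p)
    (hp01 : ∀ t ∈ Set.Icc 0 T, p t = 0 ∨ p t = 1) (hF : Continuous F)
    (hf0 : ∀ t, 0 ≤ f t) (hfF : ∀ t ∈ Set.Icc 0 T, f t ≤ F t) :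
    ∫ t in (0 : ℝ)..T, p t * f t ≤ ∫ t in Set.Ioc 0 T ∩ p ⁻¹' {1}, F t := by
  have hmeas : MeasurableSet (p ⁻¹' {1}) := hp (measurableSet_singleton 1)
  rw [intervalIntegral.integral_of_le hT, ← setIntegral_indicator hmeas]
  refine integral_mono_of_nonneg ?_ ?_ ?_
  · filter_upwards [ae_restrict_mem measurableSet_Ioc] with t ht
    rcases hp01 t (Set.Ioc_subset_Icc_self ht) with h | h <;> simp [h, hf0]
  · exact (hF.integrableOn_Icc.mono_set Set.Ioc_subset_Icc_self).indicator hmeas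
  · filter_upwards [ae_restrict_mem measurableSet_Ioc] with t ht
    have ht' := Set.Ioc_subset_Icc_self ht
    rcases hp01 t ht' with h | h
    · simp [h]
    · simp [h, hfF t ht']

/-- (Proposition 5.) Under TDMA-based transmission, the optimal
UAV trajectory is hover-fly-hover with hovering possible only at the points above
the two users: every point of `C_TD(V, T, P)` is componentwise dominated by a pair
that is TDMA-achievable for an HFH trajectory with `t_I > 0` only if `x_I = -D/2`
and `t_F > 0` only if `x_F = D/2`. -/
theorem tdma_hfh_hover_only_above_users (D H β0 P V T : ℝ)
    (hD : 0 < D) (hH : 0 < H) (hβ : 0 < β0) (hP : 0 < P) (hV : 0 < V) (hT : 0 < T) :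
    ∀ r ∈ CTD D H β0 P V T, ∃ xI xF tI tF : ℝ,
      -(D / 2) ≤ xI ∧ xI ≤ xF ∧ xF ≤ D / 2 ∧
      0 ≤ tI ∧ 0 ≤ tF ∧ tI + (xF - xI) / V + tF = T ∧
      (0 < tI → xI = -(D / 2)) ∧ (0 < tF → xF = D / 2) ∧
      ∃ π1 π2 r1' r2',
        TDMASchedule T π1 π2 ∧ r.1 ≤ r1' ∧ r.2 ≤ r2' ∧
        TDMAAchievable D H β0 P T (hfh V T xI xF tI tF) π1 π2 r1' r2' := by
  rintro ⟨r₁, r₂⟩ ⟨x, π₁, π₂, hx, ⟨hπ₁, hπ₂, hπ⟩, hr₁, hr₂, hle₁, hle₂⟩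
  dsimp only at hr₁ hr₂ hle₁ hle₂ ⊢
  set g : ℝ → ℝ := fun u => Real.logb 2 (1 + P * h1 D H β0 u) with hg
  have hgc : Continuous g := continuous_rate hH hβ hP
  have hg0 : ∀ u, 0 ≤ g u := rate_nonneg hβ hP
  have hanti : AntitoneOn g (Set.Ici (-(D / 2))) := antitoneOn_rate hH hβ hP
  have hclamp : ∀ u, g u ≤ g (max (-(D / 2)) (min (D / 2) u)) := fun u =>
    rate_le_rate hH hβ hP (abs_clamp_add_le D u)
  have hg2 : ∀ u, Real.logb 2 (1 + P * h2 D H β0 u) = g (-u) := fun u => by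
    rw [h2_eq_h1_neg]
  obtain ⟨X, hX, hXD, hXx⟩ := hx.exists_lipschitz_clamp hD hV
  set A₁ : Set ℝ := Set.Ioc 0 T ∩ π₁ ⁻¹' {1} with hA₁
  set A₂ : Set ℝ := Set.Ioc 0 T ∩ π₂ ⁻¹' {1} with hA₂
  have hA₁T : A₁ ⊆ Set.Icc 0 T := Set.inter_subset_left.trans Set.Ioc_subset_Icc_self
  have hA₂T : A₂ ⊆ Set.Icc 0 T := Set.inter_subset_left.trans Set.Ioc_subset_Icc_self
  have hbound₁ := intervalIntegral_schedule_le (F := fun t => g (X t)) hT.le hπ₁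
    (fun t ht => (hπ t ht).1) (hgc.comp hX.continuous) (fun t => hg0 (x t))
    (fun t ht => by simpa only [hXx t ht] using hclamp (x t))
  have hbound₂ := intervalIntegral_schedule_le (F := fun t => g (-X t)) hT.le hπ₂
    (fun t ht => (hπ t ht).2.1) (hgc.comp hX.continuous.neg) (fun t => hg0 (-x t))
    (fun t ht => by simpa only [hXx t ht, neg_clamp hD] using hclamp (-x t))
  have hdisj : Disjoint A₁ A₂ := by
    rw [Set.disjoint_left]
    rintro t ⟨ht, h₁⟩ ⟨-, h₂⟩
    have h := (hπ t (Set.Ioc_subset_Icc_self ht)).2.2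
    rw [Set.mem_preimage, Set.mem_singleton_iff] at h₁ h₂
    linarith
  have hvol : volume A₁ + volume A₂ ≤ ENNReal.ofReal T := by
    rw [← measure_union hdisj (measurableSet_Ioc.inter (hπ₂ (measurableSet_singleton 1)))]
    refine (measure_mono (Set.union_subset hA₁T hA₂T)).trans ?_
    simp
  have hfin : volume A₁ ≠ ⊤ := ne_top_of_le_ne_top ENNReal.ofReal_ne_top
    (le_self_add.trans hvol)
  set s : ℝ := (volume A₁).toReal with hs
  have hsA : ENNReal.ofReal s = volume A₁ := ENNReal.ofReal_toReal hfin
  have hs0 : 0 ≤ s := ENNReal.toReal_nonneg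
  have hsT : s ≤ T := ENNReal.toReal_le_of_le_ofReal hT.le (le_self_add.trans hvol)
  have hvol₂ : volume A₂ ≤ ENNReal.ofReal (T - s) := by
    rw [ENNReal.ofReal_sub _ hs0, hsA]
    exact ENNReal.le_sub_of_add_le_left hfin hvol
  obtain ⟨c, ⟨a, ha, hac⟩, ⟨b, hb, hcb⟩, hlt, hgt⟩ := exists_quantile hX.continuous hs0 hsT
  obtain ⟨xI, xF, tI, tF, hI, hIF, hF, htI, htF, hsum, hI', hF', hfly⟩ :=
    exists_hfh_eq_clamp hV hs0 hsT ((hXD a).1.trans hac) (hcb.trans (hXD b).2)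
  refine ⟨xI, xF, tI, tF, hI, hIF, hF, htI, htF, hsum, hI', hF', ?_⟩
  set Y : ℝ → ℝ := fun t => max (-(D / 2)) (min (D / 2) (c + V * (t - s))) with hY
  have hYc : Continuous Y := by fun_prop
  have hserve₁ : ∫ t in A₁, g (X t) ≤ ∫ t in Set.Ioc 0 s, g (Y t) :=
    setIntegral_le_of_quantile hV hX (fun t => (hXD t).1) hYc (fun t => le_max_left _ _)
      (fun t _ => max_le_max le_rfl ((min_le_right _ _).trans (by linarith))) hgc hg0 hanti
      ⟨b, hb, hcb⟩ hlt hA₁T hsA.ge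
  have hserve₂ : ∫ t in A₂, g (-X t) ≤ ∫ t in Set.Ioc 0 (T - s), g (-Y (T - t)) := by
    refine setIntegral_le_of_quantile (X := fun t => -X t) (c := -c) hV hX.neg
      (fun t => neg_le_neg (hXD t).2) (by fun_prop) (fun t => ?_) (fun t _ => ?_) hgc hg0 hanti
      ⟨a, ha, neg_le_neg hac⟩ ?_ hA₂T hvol₂
    · simp only [hY, neg_clamp hD, le_max_left]
    · simp only [hY, neg_clamp hD]
      exact max_le_max le_rfl ((min_le_right _ _).trans (by linarith))
    · convert hgt using 3
      ext t
      simp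
  have hT' : (0 : ℝ) ≤ 1 / T := by positivity
  refine ⟨(Set.Iic s).indicator 1, (Set.Ioi s).indicator 1, r₁, r₂,
    ⟨measurable_one.indicator measurableSet_Iic, measurable_one.indicator measurableSet_Ioi,
      fun t _ => ?_⟩, le_rfl, le_rfl, hr₁, hr₂, ?_, ?_⟩
  · rcases le_or_gt t s with h | h
    · simp [h]
    · simp [h]
  · refine hle₁.trans (mul_le_mul_of_nonneg_left ((hbound₁.trans hserve₁).trans_eq ?_) hT')
    rw [intervalIntegral.integral_of_le hT.le, ← min_eq_right hsT, ← Set.Ioc_inter_Iic,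
      min_eq_right hsT, ← setIntegral_indicator measurableSet_Iic]
    refine setIntegral_congr_fun measurableSet_Ioc fun t ht => ?_
    by_cases h : t ≤ s <;> simp [h, hfly t (Set.Ioc_subset_Icc_self ht), hg, hY]
  · simp only [hg2] at hle₂ ⊢
    refine hle₂.trans (mul_le_mul_of_nonneg_left ((hbound₂.trans hserve₂).trans_eq ?_) hT')
    rw [← intervalIntegral.integral_of_le (sub_nonneg.2 hsT),
      intervalIntegral.integral_comp_sub_left (fun t => g (-Y t)) T, sub_sub_cancel, sub_zero,
      intervalIntegral.integral_of_le hsT, intervalIntegral.integral_of_le hT.le,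
      ← max_eq_right hs0, ← Set.Ioc_inter_Ioi, max_eq_right hs0,
      ← setIntegral_indicator measurableSet_Ioi]
    refine setIntegral_congr_fun measurableSet_Ioc fun t ht => ?_
    by_cases h : s < t <;> simp [h, hfly t (Set.Ioc_subset_Icc_self ht), hY]
end

section
/- Let x : [0,T] → [-D/2, D/2] be nondecreasing and let π1, π2 : [0,T] → {0,1} be measurable with π1(t) + π2(t) ≤ 1 for all t. Then there exists t1 ∈ [0, T] such that ∫₀^{t1} log2(1 + P̄ h1(x(t))) dt ≥ ∫₀ᵀ π1(t) log2(1 + P̄ h1(x(t))) dt and ∫_{t1}^{T} log2(1 + P̄ h2(x(t))) dt ≥ ∫₀ᵀ π2(t) log2(1 + P̄ h2(x(t))) dt. That is, for a unidirectional trajectory, the threshold TDMA schedule that serves user 1 on an initial interval and user 2 on the remaining interval achieves rates componentwise at least those of any TDMA schedule. -/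
open MeasureTheory

theorem intervalIntegrable_mul_antitoneOn {f w : ℝ → ℝ} {a b : ℝ} (hab : a ≤ b)
    (hf : AntitoneOn f (Set.Icc a b)) (hw : IntervalIntegrable w volume a b) :
    IntervalIntegrable (fun t => w t * f t) volume a b := by
  have hfi : IntervalIntegrable f volume a b := by
    apply AntitoneOn.intervalIntegrable
    rwa [Set.uIcc_of_le hab]
  rw [intervalIntegrable_iff_integrableOn_Ioc_of_le hab] at *
  refine Integrable.mul_bdd (c := max |f b| |f a|) hw hfi.aestronglyMeasurable ?_
  refine (ae_restrict_iff' measurableSet_Ioc).2 (Filter.Eventually.of_forall fun t ht => ?_)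
  have h₁ := hf (Set.left_mem_Icc.2 hab) (Set.Ioc_subset_Icc_self ht) ht.1.le
  have h₂ := hf (Set.Ioc_subset_Icc_self ht) (Set.right_mem_Icc.2 hab) ht.2
  rw [Real.norm_eq_abs]
  exact abs_le_max_abs_abs h₂ h₁

/-- Among weights in `[0, 1]` of mass at most `s - a`, the integral of an antitone function is
maximized by the weight concentrated on `[a, s]`. -/
theorem integral_mul_le_of_antitoneOn {f w : ℝ → ℝ} {a b s : ℝ} (hs : s ∈ Set.Icc a b)
    (hf : AntitoneOn f (Set.Icc a b)) (hfs : 0 ≤ f s)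
    (hw : IntervalIntegrable w volume a b) (hw01 : ∀ t ∈ Set.Icc a b, w t ∈ Set.Icc (0 : ℝ) 1)
    (hmass : ∫ t in a..b, w t ≤ s - a) :
    ∫ t in a..b, w t * f t ≤ ∫ t in a..s, f t := by
  obtain ⟨has, hsb⟩ := hs
  have hl : Set.Icc a s ⊆ Set.Icc a b := Set.Icc_subset_Icc_right hsb
  have hr : Set.Icc s b ⊆ Set.Icc a b := Set.Icc_subset_Icc_left has
  have hwl : IntervalIntegrable w volume a s :=
    hw.mono_set (by rwa [Set.uIcc_of_le has, Set.uIcc_of_le (has.trans hsb)])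
  have hwr : IntervalIntegrable w volume s b :=
    hw.mono_set (by rwa [Set.uIcc_of_le hsb, Set.uIcc_of_le (has.trans hsb)])
  have hfl : IntervalIntegrable f volume a s := by
    apply AntitoneOn.intervalIntegrable
    rw [Set.uIcc_of_le has]
    exact hf.mono hl
  have hwfl := intervalIntegrable_mul_antitoneOn has (hf.mono hl) hwl
  have hwfr := intervalIntegrable_mul_antitoneOn hsb (hf.mono hr) hwr
  have left_le : ∫ t in a..s, (w t * f t + f s * (1 - w t)) ≤ ∫ t in a..s, f t := by
    refine intervalIntegral.integral_mono_on has
      (hwfl.add ((intervalIntegrable_const.sub hwl).const_mul _)) hfl fun t ht => ?_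
    have h₁ := hf (hl ht) ⟨has, hsb⟩ ht.2
    have h₂ := (hw01 t (hl ht)).2
    nlinarith [mul_nonneg (sub_nonneg.2 h₁) (sub_nonneg.2 h₂)]
  have right_le : ∫ t in s..b, w t * f t ≤ ∫ t in s..b, f s * w t := by
    refine intervalIntegral.integral_mono_on hsb hwfr (hwr.const_mul _) fun t ht => ?_
    have h₁ := hf ⟨has, hsb⟩ (hr ht) ht.1
    rw [mul_comm]
    exact mul_le_mul_of_nonneg_right h₁ (hw01 t (hr ht)).1
  rw [intervalIntegral.integral_add hwfl ((intervalIntegrable_const.sub hwl).const_mul _),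
    intervalIntegral.integral_const_mul, intervalIntegral.integral_sub intervalIntegrable_const hwl,
    intervalIntegral.integral_const, smul_eq_mul, mul_one] at left_le
  rw [intervalIntegral.integral_const_mul] at right_le
  rw [← intervalIntegral.integral_add_adjacent_intervals hwl hwr] at hmass
  rw [← intervalIntegral.integral_add_adjacent_intervals hwfl hwfr]
  nlinarith [mul_le_mul_of_nonneg_left hmass hfs]

/-- Among weights in `[0, 1]` of mass at most `b - s`, the integral of a monotone function is
maximized by the weight concentrated on `[s, b]`. -/
theorem integral_mul_le_of_monotoneOn {f w : ℝ → ℝ} {a b s : ℝ} (hs : s ∈ Set.Icc a b)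
    (hf : MonotoneOn f (Set.Icc a b)) (hfs : 0 ≤ f s)
    (hw : IntervalIntegrable w volume a b) (hw01 : ∀ t ∈ Set.Icc a b, w t ∈ Set.Icc (0 : ℝ) 1)
    (hmass : ∫ t in a..b, w t ≤ b - s) :
    ∫ t in a..b, w t * f t ≤ ∫ t in s..b, f t := by
  have hneg : ∀ t ∈ Set.Icc (-b) (-a), -t ∈ Set.Icc a b :=
    fun t ht => ⟨by linarith [ht.2], by linarith [ht.1]⟩
  have key := integral_mul_le_of_antitoneOn (f := fun t => f (-t)) (w := fun t => w (-t))
    (a := -b) (b := -a) (s := -s) ⟨neg_le_neg hs.2, neg_le_neg hs.1⟩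
    (fun u hu v hv huv => hf (hneg v hv) (hneg u hu) (neg_le_neg huv))
    (by simpa using hfs) (by simpa using (hw.comp_sub_left 0).symm)
    (fun t ht => hw01 _ (hneg t ht))
    (by rw [intervalIntegral.integral_comp_neg, neg_neg, neg_neg]; linarith)
  rwa [intervalIntegral.integral_comp_neg (fun t => w t * f t),
    intervalIntegral.integral_comp_neg f, neg_neg, neg_neg, neg_neg] at key

theorem logb_one_add_mul_div_nonneg {P β d : ℝ} (hP : 0 ≤ P) (hβ : 0 ≤ β) (hd : 0 ≤ d) :
    0 ≤ Real.logb 2 (1 + P * (β / d)) :=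
  Real.logb_nonneg one_lt_two (le_add_of_nonneg_right (by positivity))

theorem logb_one_add_mul_div_le {P β d d' : ℝ} (hP : 0 ≤ P) (hβ : 0 ≤ β) (hd : 0 < d)
    (hdd' : d ≤ d') : Real.logb 2 (1 + P * (β / d')) ≤ Real.logb 2 (1 + P * (β / d)) := by
  have hd' := hd.trans_le hdd'
  refine Real.logb_le_logb_of_le one_lt_two (by positivity) ?_
  gcongr

theorem intervalIntegrable_of_mem_Icc_zero_one {w : ℝ → ℝ} {a b : ℝ} (hab : a ≤ b)
    (hw : Measurable w) (hw01 : ∀ t ∈ Set.Icc a b, w t ∈ Set.Icc (0 : ℝ) 1) :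
    IntervalIntegrable w volume a b := by
  refine (intervalIntegrable_const (c := (1 : ℝ))).mono_fun hw.aestronglyMeasurable ?_
  rw [Set.uIoc_of_le hab]
  refine (ae_restrict_iff' measurableSet_Ioc).2 (Filter.Eventually.of_forall fun t ht => ?_)
  have h := hw01 t (Set.Ioc_subset_Icc_self ht)
  simp only [norm_one, Real.norm_of_nonneg h.1]
  exact h.2

/-- For a nondecreasing trajectory valued in `[-D/2, D/2]`, the
threshold TDMA schedule (user 1 on an initial interval `[0, t1]`, user 2 on the
remaining interval `[t1, T]`) componentwise dominates any TDMA schedule. -/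
theorem threshold_schedule_dominates (D H β0 P T : ℝ)
    (hD : 0 < D) (hH : 0 < H) (hβ : 0 < β0) (hP : 0 < P) (hT : 0 < T)
    (x π1 π2 : ℝ → ℝ)
    (hmono : MonotoneOn x (Set.Icc (0 : ℝ) T))
    (hval : ∀ t ∈ Set.Icc (0 : ℝ) T, x t ∈ Set.Icc (-(D / 2)) (D / 2))
    (hπ1 : Measurable π1) (hπ2 : Measurable π2)
    (hsched : ∀ t ∈ Set.Icc (0 : ℝ) T,
      (π1 t = 0 ∨ π1 t = 1) ∧ (π2 t = 0 ∨ π2 t = 1) ∧ π1 t + π2 t ≤ 1) :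
    ∃ t1 ∈ Set.Icc (0 : ℝ) T,
      (∫ t in (0 : ℝ)..T, π1 t * Real.logb 2 (1 + P * h1 D H β0 (x t))) ≤
        (∫ t in (0 : ℝ)..t1, Real.logb 2 (1 + P * h1 D H β0 (x t))) ∧
      (∫ t in (0 : ℝ)..T, π2 t * Real.logb 2 (1 + P * h2 D H β0 (x t))) ≤
        (∫ t in t1..T, Real.logb 2 (1 + P * h2 D H β0 (x t))) := by
  have h01₁ : ∀ t ∈ Set.Icc (0 : ℝ) T, π1 t ∈ Set.Icc (0 : ℝ) 1 := fun t ht => by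
    rcases (hsched t ht).1 with h | h <;> simp [h]
  have h01₂ : ∀ t ∈ Set.Icc (0 : ℝ) T, π2 t ∈ Set.Icc (0 : ℝ) 1 := fun t ht => by
    rcases (hsched t ht).2.1 with h | h <;> simp [h]
  have hi₁ := intervalIntegrable_of_mem_Icc_zero_one hT.le hπ1 h01₁
  have hi₂ := intervalIntegrable_of_mem_Icc_zero_one hT.le hπ2 h01₂
  have hsum : (∫ t in (0 : ℝ)..T, π1 t) + ∫ t in (0 : ℝ)..T, π2 t ≤ T := by
    rw [← intervalIntegral.integral_add hi₁ hi₂]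
    simpa using intervalIntegral.integral_mono_on hT.le (hi₁.add hi₂)
      (intervalIntegrable_const (c := (1 : ℝ))) fun t ht => (hsched t ht).2.2
  have hnn₁ : 0 ≤ ∫ t in (0 : ℝ)..T, π1 t :=
    intervalIntegral.integral_nonneg hT.le fun t ht => (h01₁ t ht).1
  have hnn₂ : 0 ≤ ∫ t in (0 : ℝ)..T, π2 t :=
    intervalIntegral.integral_nonneg hT.le fun t ht => (h01₂ t ht).1
  have hmem : ∫ t in (0 : ℝ)..T, π1 t ∈ Set.Icc (0 : ℝ) T := ⟨hnn₁, by linarith⟩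
  refine ⟨∫ t in (0 : ℝ)..T, π1 t, hmem, ?_, ?_⟩
  · refine integral_mul_le_of_antitoneOn hmem (fun u hu v hv huv => ?_)
      (logb_one_add_mul_div_nonneg hP.le hβ.le (by positivity)) hi₁ h01₁ (sub_zero _).ge
    refine logb_one_add_mul_div_le hP.le hβ.le (by positivity) ?_
    have := hmono hu hv huv
    have := (hval u hu).1
    gcongr
    linarith
  · refine integral_mul_le_of_monotoneOn hmem (fun u hu v hv huv => ?_)
      (logb_one_add_mul_div_nonneg hP.le hβ.le (by positivity)) hi₂ h01₂ (by linarith)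
    refine logb_one_add_mul_div_le hP.le hβ.le (by positivity) ?_
    have := hmono hu hv huv
    have := (hval v hv).2
    nlinarith
end

section
/- Let α1, α2 > 0, h1, h2 > 0, and P̄ > 0. Then the function p2 ↦ α1·log2(1 + p2·h2) is strictly increasing on [0, P̄], the function p2 ↦ α2·log2(1 + (P̄ − p2)·h1/(p2·h1 + 1)) is strictly decreasing on [0, P̄], and there exists a unique p2 ∈ [0, P̄] satisfying α1·log2(1 + p2·h2) = α2·log2(1 + (P̄ − p2)·h1/(p2·h1 + 1)). -/
/-- A strictly increasing and a strictly decreasing continuous function that cross on `[a, b]`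
agree at exactly one point of it. -/
theorem existsUnique_eq_of_strictMonoOn_of_strictAntiOn {f g : ℝ → ℝ} {a b : ℝ} (hab : a ≤ b)
    (hf : StrictMonoOn f (Set.Icc a b)) (hg : StrictAntiOn g (Set.Icc a b))
    (hfc : ContinuousOn f (Set.Icc a b)) (hgc : ContinuousOn g (Set.Icc a b))
    (ha : f a ≤ g a) (hb : g b ≤ f b) : ∃! x, x ∈ Set.Icc a b ∧ f x = g x := by
  obtain ⟨x, hx, hfg⟩ := isPreconnected_Icc.intermediate_value₂ (Set.left_mem_Icc.2 hab)
    (Set.right_mem_Icc.2 hab) hfc hgc ha hb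
  refine ⟨x, ⟨hx, hfg⟩, fun y ⟨hy, hyfg⟩ => ?_⟩
  rcases lt_trichotomy y x with h | h | h
  · linarith [hf hy hx h, hg hy hx h]
  · exact h
  · linarith [hf hx hy h, hg hx hy h]

/-- One plus the signal-to-interference-plus-noise ratio, as a single fraction. -/
theorem one_add_sinr_eq {p h P : ℝ} (hp : 0 ≤ p) (hh : 0 < h) :
    1 + (P - p) * h / (p * h + 1) = (P * h + 1) / (p * h + 1) := by
  have : p * h + 1 ≠ 0 := by positivity
  field_simp
  ring

/-- For `α1, α2 > 0`, `h1, h2 > 0`, `P̄ > 0`: the left-hand side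
of the rate-profile constraint (28), `p2 ↦ α1 log2(1 + p2 h2)`, is strictly
increasing on `[0, P̄]`, the right-hand side
`p2 ↦ α2 log2(1 + (P̄ - p2) h1 / (p2 h1 + 1))` is strictly decreasing on `[0, P̄]`,
and there is a unique `p2 ∈ [0, P̄]` at which they are equal. -/
theorem power_split_unique (α1 α2 h1 h2 P : ℝ)
    (hα1 : 0 < α1) (hα2 : 0 < α2) (hh1 : 0 < h1) (hh2 : 0 < h2) (hP : 0 < P) :
    StrictMonoOn (fun p2 : ℝ => α1 * Real.logb 2 (1 + p2 * h2)) (Set.Icc 0 P) ∧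
    StrictAntiOn (fun p2 : ℝ =>
      α2 * Real.logb 2 (1 + (P - p2) * h1 / (p2 * h1 + 1))) (Set.Icc 0 P) ∧
    (∃! p2 : ℝ, p2 ∈ Set.Icc (0 : ℝ) P ∧
      α1 * Real.logb 2 (1 + p2 * h2) =
        α2 * Real.logb 2 (1 + (P - p2) * h1 / (p2 * h1 + 1))) := by
  have hmono : StrictMonoOn (fun p2 : ℝ => α1 * Real.logb 2 (1 + p2 * h2)) (Set.Icc 0 P) := by
    intro x hx y hy hxy
    have := hx.1
    exact mul_lt_mul_of_pos_left
      (Real.logb_lt_logb one_lt_two (by positivity) (by gcongr)) hα1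
  have hanti : StrictAntiOn (fun p2 : ℝ =>
      α2 * Real.logb 2 (1 + (P - p2) * h1 / (p2 * h1 + 1))) (Set.Icc 0 P) := by
    intro x hx y hy hxy
    have hx0 := hx.1
    have hy0 := hy.1
    simp only [one_add_sinr_eq hx0 hh1, one_add_sinr_eq hy0 hh1]
    exact mul_lt_mul_of_pos_left
      (Real.logb_lt_logb one_lt_two (by positivity) (by gcongr)) hα2
  refine ⟨hmono, hanti, existsUnique_eq_of_strictMonoOn_of_strictAntiOn hP.le hmono hanti
    ?_ ?_ ?_ ?_⟩
  · refine continuousOn_const.mul (ContinuousOn.logb (by fun_prop) fun x hx => ?_)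
    have := hx.1
    positivity
  · refine continuousOn_const.mul (ContinuousOn.logb
      (continuousOn_const.add (ContinuousOn.div (by fun_prop) (by fun_prop) fun x hx => ?_))
      fun x hx => ?_)
    · have := hx.1
      positivity
    · have := hx.1
      rw [one_add_sinr_eq this hh1]
      positivity
  · have : 0 ≤ Real.logb 2 (1 + P * h1) :=
      Real.logb_nonneg one_lt_two (le_add_of_nonneg_right (by positivity))
    simpa using mul_nonneg hα2.le this
  · have : 0 ≤ Real.logb 2 (1 + P * h2) :=
      Real.logb_nonneg one_lt_two (le_add_of_nonneg_right (by positivity))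
    simpa using mul_nonneg hα1.le this
end
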